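/- arXiv:2509.14838 — 2 statements merged into one kernel-verified Lean document; each statement's English description precedes it below -/
import Mathlib

section
/- Let Δ be a simplicial complex with dim Δ = 1 and ℓ ≥ 1. Then depth(S/I_Δ^(ℓ)) ≥ depth(S/I_Δ^(ℓ+1)). Moreover, if Δ is pure, then S_2-depth(S/I_Δ^(ℓ)) ≥ S_2-depth(S/I_Δ^(ℓ+1)). -/
/-!
Common definitions for formalizing "The Serre depth of Stanley–Reisner rings and
the depth of their symbolic powers" (Muta–Terai).
-/

open CategoryTheory MvPolynomial

noncomputable section

namespace SerrePaper

/-! ### Simplicial complexes (given by their sets of faces) -/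

variable {V : Type}

/-- A (nonempty, downward closed) abstract simplicial complex, given by its set of faces. -/
def IsComplex (K : Set (Finset V)) : Prop :=
  K.Nonempty ∧ ∀ F ∈ K, ∀ G ⊆ F, G ∈ K

/-- `F` is a facet (maximal face) of `K`. -/
def IsFacet (K : Set (Finset V)) (F : Finset V) : Prop :=
  F ∈ K ∧ ∀ G ∈ K, F ⊆ G → G = F

/-- `K` is pure: all facets have the same cardinality. -/
def Pure (K : Set (Finset V)) : Prop :=
  ∀ F G : Finset V, IsFacet K F → IsFacet K G → F.card = G.card

/-- `dim K = d - 1`, i.e. the maximal cardinality of a face of `K` is `d`. -/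
def HasDimCard (K : Set (Finset V)) (d : ℕ) : Prop :=
  (∃ F ∈ K, F.card = d) ∧ ∀ F ∈ K, F.card ≤ d

/-- the link of the face `F` in `K`. -/
def link [DecidableEq V] (K : Set (Finset V)) (F : Finset V) : Set (Finset V) :=
  { G | G ∪ F ∈ K ∧ G ∩ F = ∅ }

/-- `skeleton K t` is the `(t-1)`-skeleton `K^{t-1}` of `K`:
all faces with at most `t` vertices. -/
def skeleton (K : Set (Finset V)) (t : ℕ) : Set (Finset V) :=
  { F ∈ K | F.card ≤ t }

/-- The Alexander dual complex `K^∨ = { F | complement of F is not a face of K }`. -/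
def dualComplex [Fintype V] [DecidableEq V] (K : Set (Finset V)) : Set (Finset V) :=
  { F | Fᶜ ∉ K }

/-- The copy of `K` on its own vertex set (as a complex on the corresponding subtype). -/
def restrictVerts (K : Set (Finset V)) : Set (Finset {v : V // {v} ∈ K}) :=
  { F | F.map (Function.Embedding.subtype _) ∈ K }

/-- The induced subcomplex `K_W` on a subset `W` of the vertices. -/
def inducedSub (K : Set (Finset V)) (W : Finset V) : Set (Finset V) :=
  { F ∈ K | F ⊆ W }

/-- `K` is a matroid complex: every induced subcomplex is pure. -/
def IsMatroidComplex (K : Set (Finset V)) : Prop :=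
  ∀ W : Finset V, Pure (inducedSub K W)

/-! ### Reduced simplicial homology with coefficients in a field `k` -/

/-- The group of simplicial `(c-1)`-chains: formal `k`-linear combinations of the
faces of `K` with exactly `c` vertices. -/
abbrev chainGroup (k : Type) [Field k] (K : Set (Finset V)) (c : ℕ) : Type :=
  {F : Finset V // F ∈ K ∧ F.card = c} →₀ k

open Classical in
/-- the boundary of a single face, `∂F = ∑_{x ∈ F} (-1)^{pos of x in F} (F \ {x})`. -/
def boundaryAt (k : Type) [Field k] [LinearOrder V] (K : Set (Finset V)) (c : ℕ)
    (F : {F : Finset V // F ∈ K ∧ F.card = c + 1}) : chainGroup k K c :=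
  ∑ x ∈ F.1.attach,
    if h : F.1.erase x.1 ∈ K then
      Finsupp.single
        ⟨F.1.erase x.1, h, by simp [Finset.card_erase_of_mem x.2, F.2.2]⟩
        ((-1 : k) ^ (F.1.filter (fun y => y < x.1)).card)
    else 0

/-- The simplicial boundary map (for a downward closed `K` this is the usual
boundary map of the reduced (augmented) chain complex of `K`, where faces with
`c` vertices sit in homological degree `c - 1`). -/
def boundary (k : Type) [Field k] [LinearOrder V] (K : Set (Finset V)) (c : ℕ) :
    chainGroup k K (c + 1) →ₗ[k] chainGroup k K c :=
  Finsupp.lsum k fun F => LinearMap.toSpanSingleton k _ (boundaryAt k K c F)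

/-- `H̃ᵢ(K; k) = 0`: every reduced `i`-cycle is a boundary.  (For `i ≤ -2` this holds
trivially; for `i = -1` the relevant cycle group is the whole of the `(-1)`-chains.) -/
def reducedHomologyVanishes (k : Type) [Field k] [LinearOrder V]
    (K : Set (Finset V)) (i : ℤ) : Prop :=
  if i < -1 then True
  else if i = -1 then
    ∀ z : chainGroup k K 0, ∃ b : chainGroup k K 1, boundary k K 0 b = z
  else
    ∀ z : chainGroup k K (i.toNat + 1), boundary k K i.toNat z = 0 →
      ∃ b : chainGroup k K (i.toNat + 2), boundary k K (i.toNat + 1) b = z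

/-- Nonvanishing `β_{i,j}(k[K]) ≠ 0` of the graded Betti numbers of the
Stanley–Reisner ring of `K`, expressed via Hochster's formula:
`β_{i,j}(k[K]) = ∑_{W ⊆ V, |W| = j} dim_k H̃_{j-i-1}(K_W; k)`. -/
def bettiNonzero (k : Type) [Field k] [LinearOrder V] (K : Set (Finset V)) (i j : ℕ) : Prop :=
  ∃ W : Finset V, W.card = j ∧
    ¬ reducedHomologyVanishes k (inducedSub K W) ((j : ℤ) - i - 1)

/-- `reg_{≤ r} I_K = max{ j : β_{i,i+j}(I_K) ≠ 0 for some i ≤ r }`, where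
`β_{i,d}(I_K) = β_{i+1,d}(k[K])`. -/
def regLEIdeal (k : Type) [Field k] [LinearOrder V] (K : Set (Finset V)) (r : ℕ) : ℕ :=
  sSup { j : ℕ | ∃ i ≤ r, bettiNonzero k K (i + 1) (i + j) }

/-- `indeg I_K`: the least degree of a minimal generator of the Stanley–Reisner
ideal of `K`, i.e. `min{ j : β_{0,j}(I_K) = β_{1,j}(k[K]) ≠ 0 }`. -/
def indegIdeal (k : Type) [Field k] [LinearOrder V] (K : Set (Finset V)) : ℕ :=
  sInf { j : ℕ | bettiNonzero k K 1 j }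

/-! ### Stanley–Reisner rings, Serre depth, depth, symbolic powers -/

variable (k : Type) [Field k]

/-- The Stanley–Reisner ideal of `K` (generated by the monomials of the non-faces,
equivalently by those of the minimal non-faces). -/
def srIdeal (K : Set (Finset V)) : Ideal (MvPolynomial V k) :=
  Ideal.span { m | ∃ F : Finset V, F ∉ K ∧ m = ∏ i ∈ F, X i }

/-- The homogeneous maximal ideal `(x_v : v ∈ V)` of the polynomial ring. -/
def maxIdeal (V : Type) : Ideal (MvPolynomial V k) :=
  Ideal.span (Set.range X)

/-- The quotient ring `S/I` as an object of `ModuleCat S`. -/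
def quotMod {V : Type} (I : Ideal (MvPolynomial V k)) : ModuleCat (MvPolynomial V k) :=
  ModuleCat.of _ (MvPolynomial V k ⧸ I)

/-- The Stanley–Reisner ring `k[K] = S/I_K` as a module over `S`. -/
def srRing (K : Set (Finset V)) : ModuleCat (MvPolynomial V k) :=
  quotMod k (srIdeal k K)

/-- The Krull dimension of a module, `dim M = dim (R / ann M)` (so `dim 0 = ⊥ = -∞`). -/
def modDim {R : Type} [CommRing R] (M : ModuleCat R) : WithBot ℕ∞ :=
  ringKrullDim (R ⧸ Module.annihilator R M)

/-- `Ext_R^i(M, N)` as an `R`-module. -/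
def extM {R : Type} [CommRing R] (M N : ModuleCat R) (i : ℕ) : ModuleCat R :=
  ((Ext R (ModuleCat R) i).obj (Opposite.op M)).obj N

/-- `K_M^j = Ext_S^{n-j}(M, ω_S)`, the (Matlis dual of) local cohomology; since the
canonical module `ω_S` of the polynomial ring `S` is `S` itself up to a
grading shift, we use `Ext_S^{n-j}(M, S)`. -/
def serreK {V : Type} (M : ModuleCat (MvPolynomial V k)) (j : ℕ) :
    ModuleCat (MvPolynomial V k) :=
  extM M (ModuleCat.of _ (MvPolynomial V k)) (Nat.card V - j)

/-- The Serre depth `S_r-depth(M) = min{ j : dim K_M^j ≥ j - r + 1 }`.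
(Note that, since `dim K_M^j` is either `⊥` or `≥ 0`, the inequality
`dim K_M^j ≥ j - r + 1` of (possibly negative) integers is equivalent to
`(j + 1 - r : ℕ) ≤ dim K_M^j` with truncated subtraction.) -/
def serreDepth {V : Type} (r : ℕ) (M : ModuleCat (MvPolynomial V k)) : ℕ :=
  sInf { j : ℕ | ((j + 1 - r : ℕ) : WithBot ℕ∞) ≤ modDim (serreK k M j) }

/-- Serre's condition `(S_r)` for an unmixed module: `S_r-depth(M) = dim M`. -/
def serreCond {V : Type} (r : ℕ) (M : ModuleCat (MvPolynomial V k)) : Prop :=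
  (serreDepth k r M : WithBot ℕ∞) = modDim M

/-- The depth of `M` with respect to the homogeneous maximal ideal,
via Rees' characterization `depth M = min{ i : Ext^i(S/m, M) ≠ 0 }`. -/
def mdepth {V : Type} (M : ModuleCat (MvPolynomial V k)) : ℕ :=
  sInf { i : ℕ | Nontrivial (extM (quotMod k (maxIdeal k V)) M i) }

/-- `M` is Cohen–Macaulay: `depth M = dim M`. -/
def isCM {V : Type} (M : ModuleCat (MvPolynomial V k)) : Prop :=
  (mdepth k M : WithBot ℕ∞) = modDim M

/-- The `ℓ`-th symbolic power of a (radical, e.g. squarefree monomial) ideal: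
`I^(ℓ) = ⋂_{P ∈ Min(I)} P^ℓ`. -/
def symbPow {R : Type} [CommRing R] (I : Ideal R) (ℓ : ℕ) : Ideal R :=
  sInf { J | ∃ P ∈ I.minimalPrimes, J = P ^ ℓ }

/-- The height of an ideal: the Krull dimension of the poset of primes contained in it. -/
def idealHeight {R : Type} [CommRing R] (p : Ideal R) : WithBot ℕ∞ :=
  Order.krullDim { q : PrimeSpectrum R // q.asIdeal ≤ p }

/-- `R/I` is unmixed: all associated primes of `R/I` have the same height. -/
def IsUnmixedIdeal {R : Type} [CommRing R] (I : Ideal R) : Prop :=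
  ∀ p q : Ideal R, p ∈ associatedPrimes R (R ⧸ I) → q ∈ associatedPrimes R (R ⧸ I) →
    idealHeight p = idealHeight q

/-- Nonvanishing of the first local cohomology `H_m^1(S/I) ≠ 0`. -/
def H1NE {V : Type} (I : Ideal (MvPolynomial V k)) : Prop :=
  Nontrivial ((localCohomology (maxIdeal k V) 1).obj (quotMod k I))

/-- `I` is a squarefree monomial ideal. -/
def IsSqFreeMonomialIdeal {V : Type} (I : Ideal (MvPolynomial V k)) : Prop :=
  ∃ G : Set (Finset V), I = Ideal.span ((fun F => ∏ i ∈ F, X i) '' G)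

end SerrePaper

end

namespace SerrePaper

open Abelian

/-! ### Comparison of the two versions of `Ext` -/

section ExtComparison

variable {R : Type} [CommRing R]

theorem forall_smul_eq_zero_congr {M N : Type*} [AddCommGroup M] [Module R M] [AddCommGroup N]
    [Module R N] (e : M ≃ₗ[R] N) (r : R) : (∀ z : M, r • z = 0) ↔ ∀ z : N, r • z = 0 := by
  constructor
  · intro h z
    have := congrArg e (h (e.symm z))
    rwa [map_smul, map_zero, LinearEquiv.apply_symm_apply] at this
  · intro h z
    apply e.injective
    rw [map_smul, map_zero]
    exact h _

theorem smul_homology_eq_zero_iff (T : ShortComplex (ModuleCat.{0} R)) (r : R) :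
    (∀ z : T.homology, r • z = 0) ↔
      ∀ x : T.X₂, T.g x = 0 → ∃ y : T.X₁, T.f y = r • x := by
  have e : (∀ z : T.homology, r • z = 0) ↔
      ∀ z : (LinearMap.ker T.g.hom ⧸ LinearMap.range T.moduleCatToCycles), r • z = 0 :=
    forall_smul_eq_zero_congr T.moduleCatHomologyIso.toLinearEquiv r
  rw [e]
  constructor
  · intro h x hx
    have := h (Submodule.Quotient.mk ⟨x, hx⟩)
    rw [← Submodule.Quotient.mk_smul, Submodule.Quotient.mk_eq_zero] at this
    obtain ⟨y, hy⟩ := this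
    exact ⟨y, congrArg Subtype.val hy⟩
  · intro h z
    obtain ⟨⟨x, hx⟩, rfl⟩ := Submodule.Quotient.mk_surjective _ z
    rw [← Submodule.Quotient.mk_smul, Submodule.Quotient.mk_eq_zero]
    obtain ⟨y, hy⟩ := h x hx
    exact ⟨y, Subtype.ext hy⟩

theorem smul_extM_eq_zero_iff (X Y : ModuleCat.{0} R) (i : ℕ) (r : R) :
    (∀ z : extM X Y i, r • z = 0) ↔ ∀ e : Abelian.Ext X Y i, r • e = 0 := by
  let P := ProjectiveResolution.of X
  let L := P.complex.linearYonedaObj R Y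
  have key : ∀ j, (ComplexShape.up ℕ).prev i = j →
      ((∀ z : extM X Y i, r • z = 0) ↔ ∀ f : P.complex.X i ⟶ Y,
        P.complex.d (i + 1) i ≫ f = 0 →
          ∃ g : P.complex.X j ⟶ Y, P.complex.d i j ≫ g = r • f) := by
    intro j hj
    have e : extM X Y i ≅ (L.sc' j i (i + 1)).homology :=
      P.isoExt (R := R) i Y ≪≫ L.homologyIsoSc' j i (i + 1) hj (by simp)
    rw [forall_smul_eq_zero_congr e.toLinearEquiv, smul_homology_eq_zero_iff]
    rfl
  rcases i with _ | i
  · obtain ⟨p, hp, hdp, hdesc⟩ : ∃ p : P.complex.X 0 ⟶ X, Epi p ∧ P.complex.d 1 0 ≫ p = 0 ∧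
        ∀ f : P.complex.X 0 ⟶ Y, P.complex.d 1 0 ≫ f = 0 → ∃ c : X ⟶ Y, p ≫ c = f :=
      ⟨P.π.f 0, inferInstanceAs (Epi (P.π.f 0)), P.complex_d_comp_π_f_zero, fun f hf =>
        ⟨(Limits.CokernelCofork.IsColimit.desc' P.exact₀.gIsCokernel f hf).1,
          (Limits.CokernelCofork.IsColimit.desc' P.exact₀.gIsCokernel f hf).2⟩⟩
    rw [key 0 (by simp), forall_smul_eq_zero_congr (Ext.linearEquiv₀ (R := R)) r]
    constructor
    · intro h f
      obtain ⟨g, hg⟩ := h (p ≫ f) (by rw [← Category.assoc, hdp, Limits.zero_comp])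
      rw [P.complex.shape _ _ (by simp), Limits.zero_comp] at hg
      rw [← cancel_epi p, Linear.comp_smul, ← hg, Limits.comp_zero]
    · intro h f hf
      obtain ⟨c, rfl⟩ := hdesc f hf
      exact ⟨0, by rw [Limits.comp_zero, ← Linear.comp_smul, h c, Limits.comp_zero]⟩
  · rw [key i (by simp)]
    have hsm : ∀ (f : P.complex.X (i + 1) ⟶ Y) (hf : P.complex.d (i + 1 + 1) (i + 1) ≫ f = 0),
        r • P.extMk f (i + 1 + 1) rfl hf = P.extMk (r • f) (i + 1 + 1) rfl (by simp [hf]) := by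
      intro f hf
      rw [Ext.smul_eq_comp_mk₀, ProjectiveResolution.extMk_comp_mk₀]
      congr 1
    constructor
    · intro h e
      obtain ⟨f, hf, rfl⟩ := P.extMk_surjective e (i + 1 + 1) rfl
      rw [hsm, P.extMk_eq_zero_iff _ _ _ _ i rfl]
      exact h f hf
    · intro h f hf
      have := h (P.extMk f (i + 1 + 1) rfl hf)
      rwa [hsm, P.extMk_eq_zero_iff _ _ _ _ i rfl] at this

theorem nontrivial_extM_iff (X Y : ModuleCat.{0} R) (i : ℕ) :
    Nontrivial (extM X Y i) ↔ Nontrivial (Abelian.Ext X Y i) := by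
  have h := smul_extM_eq_zero_iff X Y i (1 : R)
  simp only [one_smul] at h
  rw [← not_subsingleton_iff_nontrivial, ← not_subsingleton_iff_nontrivial,
    subsingleton_iff_forall_eq 0, subsingleton_iff_forall_eq 0, h]

end ExtComparison

open Abelian

/-! ### Long exact sequences for short exact sequences of modules -/

section LongExactSequences

variable (R : Type) [CommRing R]

/-- `Ext^i(M, N) = 0`. -/
def ExtZero (M N : Type) [AddCommGroup M] [Module R M] [AddCommGroup N] [Module R N]
    (i : ℕ) : Prop :=
  ∀ e : Abelian.Ext (ModuleCat.of R M) (ModuleCat.of R N) i, e = 0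

/-- `r` annihilates `Ext^i(M, N)`. -/
def ExtKill (r : R) (M N : Type) [AddCommGroup M] [Module R M] [AddCommGroup N] [Module R N]
    (i : ℕ) : Prop :=
  ∀ e : Abelian.Ext (ModuleCat.of R M) (ModuleCat.of R N) i, r • e = 0

/-- The projective dimension of `M` is smaller than `d`. -/
def PdLT (M : Type) [AddCommGroup M] [Module R M] (d : ℕ) : Prop :=
  HasProjectiveDimensionLT (ModuleCat.of R M) d

variable {R}
variable {X Y A B C : Type} [AddCommGroup X] [Module R X] [AddCommGroup Y] [Module R Y]
  [AddCommGroup A] [Module R A] [AddCommGroup B] [Module R B] [AddCommGroup C] [Module R C]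

/-- `0 → A → B → C → 0` is a short exact sequence of modules. -/
structure IsShortExact (f : A →ₗ[R] B) (g : B →ₗ[R] C) : Prop where
  inj : Function.Injective f
  surj : Function.Surjective g
  exact : Function.Exact f g

namespace IsShortExact

variable {f : A →ₗ[R] B} {g : B →ₗ[R] C}

/-- The associated short complex in the category of modules. -/
abbrev toComplex (h : IsShortExact f g) : ShortComplex (ModuleCat.{0} R) :=
  ModuleCat.shortComplexOfCompEqZero f g h.exact.linearMap_comp_eq_zero

theorem shortExact (h : IsShortExact f g) : h.toComplex.ShortExact :=
  ModuleCat.shortComplex_shortExact _ h.exact h.inj h.surj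

theorem ext_left (h : IsShortExact f g) {i : ℕ} (hC : ExtZero R X C i)
    (hB : ExtZero R X B (i + 1)) : ExtZero R X A (i + 1) := by
  intro e
  obtain ⟨e', rfl⟩ := Ext.covariant_sequence_exact₁ (ModuleCat.of R X) h.shortExact e (hB _) rfl
  rw [hC e', Ext.zero_comp]

theorem ext_right (h : IsShortExact f g) {i : ℕ} (hB : ExtZero R X B i)
    (hA : ExtZero R X A (i + 1)) : ExtZero R X C i := by
  intro e
  obtain ⟨e', rfl⟩ := Ext.covariant_sequence_exact₃ (ModuleCat.of R X) h.shortExact e rfl (hA _)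
  rw [hB e', Ext.zero_comp]

theorem ext'_left (h : IsShortExact f g) {i : ℕ} (hB : ExtZero R B Y i)
    (hC : ExtZero R C Y (i + 1)) : ExtZero R A Y i := by
  intro e
  obtain ⟨e', rfl⟩ := Ext.contravariant_sequence_exact₁ h.shortExact (ModuleCat.of R Y) e
    (add_comm _ _) (hC _)
  rw [hB e', Ext.comp_zero]

theorem ext'_right (h : IsShortExact f g) {i : ℕ} (hA : ExtZero R A Y i)
    (hB : ExtZero R B Y (i + 1)) : ExtZero R C Y (i + 1) := by
  intro e
  obtain ⟨e', rfl⟩ := Ext.contravariant_sequence_exact₃ h.shortExact (ModuleCat.of R Y) e (hB _)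
    (add_comm _ _)
  rw [hA e', Ext.comp_zero]

/-- Elements killing `Ext^i(B, Y)` kill `Ext^i(A, Y)` up to annihilators of `C`. -/
theorem extKill_left (h : IsShortExact f g) {i : ℕ} {r s : R} (hB : ExtKill R r B Y i)
    (hC : ∀ c : C, s • c = 0) :
    ExtKill R (r * s) A Y i := by
  intro e
  have key : h.shortExact.extClass.comp (s • e) (add_comm 1 i) = 0 := by
    rw [Ext.comp_smul, ← Ext.smul_comp]
    have : s • h.shortExact.extClass = 0 := by
      have h1 := Ext.smul_comp (Ext.mk₀ (𝟙 (ModuleCat.of R C))) h.shortExact.extClass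
        (zero_add 1) s
      rw [Ext.mk₀_id_comp, ← Ext.mk₀_smul] at h1
      rw [← h1]
      have : s • 𝟙 (ModuleCat.of R C) = 0 := by
        ext c
        exact hC c
      erw [this, Ext.mk₀_zero, Ext.zero_comp]
    rw [this, Ext.zero_comp]
  obtain ⟨e', he'⟩ := Ext.contravariant_sequence_exact₁ h.shortExact (ModuleCat.of R Y) (s • e)
    (add_comm _ _) key
  rw [mul_smul, ← he', ← Ext.comp_smul, hB e', Ext.comp_zero]

theorem extKill_left_of_extZero (h : IsShortExact f g) {i : ℕ} {r : R} (hB : ExtKill R r B Y i)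
    (hC : ExtZero R C Y (i + 1)) : ExtKill R r A Y i := by
  intro e
  obtain ⟨e', rfl⟩ := Ext.contravariant_sequence_exact₁ h.shortExact (ModuleCat.of R Y) e
    (add_comm _ _) (hC _)
  rw [← Ext.comp_smul, hB e', Ext.comp_zero]

theorem pdLT_middle (h : IsShortExact f g) {d : ℕ} (hA : PdLT R A d)
    (hC : PdLT R C d) : PdLT R B d :=
  h.shortExact.hasProjectiveDimensionLT_X₂ d hA hC

theorem pdLT_right (h : IsShortExact f g) {d : ℕ} (hA : PdLT R A d) (hB : PdLT R B
    (d + 1)) : PdLT R C (d + 1) :=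
  h.shortExact.hasProjectiveDimensionLT_X₃ d hA hB

end IsShortExact

theorem PdLT.mono {d d' : ℕ} (h : PdLT R A d) (hd : d ≤ d') : PdLT R A d' := by
  have : HasProjectiveDimensionLT (ModuleCat.of R A) d := h
  exact hasProjectiveDimensionLT_of_ge _ d d' hd

theorem PdLT.extZero {d i : ℕ} (h : PdLT R A d) (hd : d ≤ i) : ExtZero R A Y i := by
  have : HasProjectiveDimensionLT (ModuleCat.of R A) d := h
  intro e
  exact e.eq_zero_of_hasProjectiveDimensionLT d hd

theorem PdLT.of_equiv {d : ℕ} (h : PdLT R A d) (e : A ≃ₗ[R] B) : PdLT R B d := by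
  have : HasProjectiveDimensionLT (ModuleCat.of R A) d := h
  exact hasProjectiveDimensionLT_of_iso e.toModuleIso d

theorem pdLT_zero_of_subsingleton [Subsingleton A] (d : ℕ) : PdLT R A d := by
  have : HasProjectiveDimensionLT (ModuleCat.of R A) 0 :=
    (ModuleCat.isZero_of_subsingleton _).hasProjectiveDimensionLT_zero
  exact PdLT.mono this (Nat.zero_le d)

theorem pdLT_one_of_free [Module.Free R A] : PdLT R A 1 := by
  have : Projective (ModuleCat.of R A) := ModuleCat.projective_of_categoryTheory_projective _
  exact (inferInstance : HasProjectiveDimensionLT (ModuleCat.of R A) 1)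

theorem extZero_zero_iff : ExtZero R X A 0 ↔ ∀ f : X →ₗ[R] A, f = 0 := by
  constructor
  · intro h f
    have := h (Ext.mk₀ (ModuleCat.ofHom f))
    rw [Ext.mk₀_eq_zero_iff] at this
    exact congrArg ModuleCat.Hom.hom this
  · intro h e
    obtain ⟨f, rfl⟩ := Ext.homEquiv₀.symm.surjective e
    rw [Ext.homEquiv₀_symm_apply, Ext.mk₀_eq_zero_iff]
    ext1
    exact h f.hom

theorem ExtZero.of_injective (h : ExtZero R X B 0) (f : A →ₗ[R] B) (hf : Function.Injective f) :
    ExtZero R X A 0 := by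
  rw [extZero_zero_iff] at h ⊢
  intro u
  ext x
  apply hf
  simpa using LinearMap.congr_fun (h (f.comp u)) x

theorem isShortExact_mkQ_range (f : A →ₗ[R] B) (hf : Function.Injective f) :
    IsShortExact f (LinearMap.range f).mkQ :=
  ⟨hf, (LinearMap.range f).mkQ_surjective, LinearMap.exact_map_mkQ_range f⟩

end LongExactSequences

/-! ### Finite global dimension of polynomial rings -/

section GlobalDimension

open TensorProduct

variable {R : Type} [CommRing R]

theorem isShortExact_ker {A B : Type} [AddCommGroup A] [Module R A] [AddCommGroup B] [Module R B]
    (p : A →ₗ[R] B) (hp : Function.Surjective p) : IsShortExact (LinearMap.ker p).subtype p :=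
  ⟨Subtype.val_injective, hp, LinearMap.exact_subtype_ker_map p⟩

theorem IsShortExact.baseChange {A B C : Type} [AddCommGroup A] [Module R A] [AddCommGroup B]
    [Module R B] [AddCommGroup C] [Module R C] {f : A →ₗ[R] B} {g : B →ₗ[R] C}
    (h : IsShortExact f g) (R' : Type) [CommRing R'] [Algebra R R'] [Module.Flat R R'] :
    IsShortExact (f.baseChange R') (g.baseChange R') :=
  ⟨Module.Flat.lTensor_preserves_injective_linearMap _ h.inj,
    LinearMap.lTensor_surjective _ h.surj, lTensor_exact _ h.exact h.surj⟩

theorem PdLT.baseChange (R' : Type) [CommRing R'] [Algebra R R'] [Module.Flat R R'] {d : ℕ}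
    {M : Type} [AddCommGroup M] [Module R M] (h : PdLT R M d) :
    PdLT R' (R' ⊗[R] M) d := by
  induction d generalizing M with
  | zero =>
    have : HasProjectiveDimensionLT (ModuleCat.of R M) 0 := h
    have := isZero_of_hasProjectiveDimensionLT_zero (ModuleCat.of R M)
    have : Subsingleton M := ModuleCat.subsingleton_of_isZero this
    exact pdLT_zero_of_subsingleton 0
  | succ d ih =>
    rcases d with _ | d
    · have : HasProjectiveDimensionLT (ModuleCat.of R M) 1 := h
      have : Projective (ModuleCat.of R M) := inferInstance
      have : Module.Projective R M := (IsProjective.iff_projective M).mpr this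
      have : Projective (ModuleCat.of R' (R' ⊗[R] M)) :=
        (IsProjective.iff_projective _).mp inferInstance
      exact (inferInstance : HasProjectiveDimensionLT (ModuleCat.of R' (R' ⊗[R] M)) 1)
    · let p : (M →₀ R) →ₗ[R] M := Finsupp.linearCombination R id
      have hp : Function.Surjective p := fun m => ⟨Finsupp.single m 1, by simp [p]⟩
      have hs := isShortExact_ker p hp
      have hK : PdLT R (LinearMap.ker p) (d + 1) :=
        hs.shortExact.hasProjectiveDimensionLT_X₁ (d + 1)
          ((pdLT_one_of_free (R := R) (A := M →₀ R)).mono (by omega)) h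
      have hs' := hs.baseChange R'
      exact hs'.pdLT_right (ih hK)
        ((pdLT_one_of_free (R := R') (A := R' ⊗[R] (M →₀ R))).mono (by omega))

variable (R) in
/-- Every `R`-module has projective dimension smaller than `d`. -/
def GlobalDimLT (d : ℕ) : Prop :=
  ∀ (M : Type) [AddCommGroup M] [Module R M], PdLT R M d

theorem GlobalDimLT.of_ringEquiv {R' : Type} [CommRing R'] (e : R ≃+* R') {d : ℕ}
    (h : GlobalDimLT R d) : GlobalDimLT R' d := by
  intro M _ _
  let _ : Algebra R R' := e.toRingHom.toAlgebra
  let _ : Module R M := Module.compHom M e.toRingHom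
  have : IsScalarTower R R' M := ⟨fun r s m => mul_smul (e r) s m⟩
  have : Module.Flat R R' := by
    have : (e.toRingHom).Flat := RingHom.Flat.of_bijective e.bijective
    exact this
  let g : R' ⊗[R] M →ₗ[R'] M :=
    (LinearMap.id : M →ₗ[R] M).liftBaseChange R'
  have hg : ∀ x, x = (1 : R') ⊗ₜ[R] g x := by
    intro x
    induction x with
    | zero => simp
    | add x y hx hy => rw [map_add, tmul_add, ← hx, ← hy]
    | tmul s m =>
      obtain ⟨r, rfl⟩ := e.surjective s
      have h1 : g (e r ⊗ₜ m) = r • m := LinearMap.liftBaseChange_tmul _ _ _ _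
      rw [h1, ← smul_tmul]
      congr 1
      exact (mul_one _).symm
  have hb : Function.Bijective g := by
    refine ⟨fun x y hxy => ?_, fun m => ⟨1 ⊗ₜ m, by simp [g]⟩⟩
    rw [hg x, hg y, hxy]
  exact ((h M).baseChange R').of_equiv (LinearEquiv.ofBijective g hb)

theorem GlobalDimLT.polynomial {d : ℕ} (h : GlobalDimLT R d) :
    GlobalDimLT (Polynomial R) (d + 1) := by
  intro M _ _
  let _ : Module R M := Module.compHom M (Polynomial.C : R →+* Polynomial R)
  have : IsScalarTower R (Polynomial R) M := ⟨fun r s m => by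
    rw [Polynomial.smul_eq_C_mul]
    exact mul_smul (Polynomial.C r) s m⟩
  let g : Polynomial R ⊗[R] M →ₗ[Polynomial R] M :=
    (LinearMap.id : M →ₗ[R] M).liftBaseChange (Polynomial R)
  have hg : ∀ (p : Polynomial R) (m : M), g (p ⊗ₜ m) = p • m :=
    fun p m => LinearMap.liftBaseChange_tmul _ _ _ _
  let τ : M →ₗ[R] M := (LinearMap.lsmul (Polynomial R) M Polynomial.X).restrictScalars R
  have hτ : ∀ m, τ m = (Polynomial.X : Polynomial R) • m := fun m => rfl
  let f : Polynomial R ⊗[R] M →ₗ[Polynomial R] Polynomial R ⊗[R] M :=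
    LinearMap.lsmul (Polynomial R) _ Polynomial.X - τ.baseChange (Polynomial R)
  have hf : ∀ (p : Polynomial R) (m : M),
      f (p ⊗ₜ m) = (Polynomial.X * p) ⊗ₜ m - p ⊗ₜ ((Polynomial.X : Polynomial R) • m) :=
    fun p m => rfl
  have hgf : ∀ x, g (f x) = 0 := by
    intro x
    induction x with
    | zero => simp
    | add x y hx hy => rw [map_add, map_add, hx, hy, add_zero]
    | tmul p m => rw [hf, map_sub, hg, hg, mul_comm, mul_smul, sub_self]
  have hmono : ∀ (n : ℕ) (m : M), (Polynomial.X ^ n : Polynomial R) ⊗ₜ[R] m -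
      1 ⊗ₜ[R] ((Polynomial.X ^ n : Polynomial R) • m) ∈ LinearMap.range f := by
    intro n
    induction n with
    | zero => intro m; simp
    | succ n ih =>
      intro m
      have h1 := ih ((Polynomial.X : Polynomial R) • m)
      have h2 : f ((Polynomial.X ^ n : Polynomial R) ⊗ₜ m) ∈ LinearMap.range f := ⟨_, rfl⟩
      rw [hf] at h2
      have := add_mem h2 h1
      rwa [sub_add_sub_cancel, ← mul_smul, ← pow_succ', ← pow_succ] at this
  have hcong : ∀ x, x - 1 ⊗ₜ[R] g x ∈ LinearMap.range f := by
    intro x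
    induction x with
    | zero => simp
    | add x y hx hy =>
      rw [map_add, tmul_add, add_sub_add_comm]
      exact add_mem hx hy
    | tmul p m =>
      rw [hg]
      induction p using Polynomial.induction_on' with
      | add p q hp hq =>
        rw [add_smul, tmul_add, add_tmul, add_sub_add_comm]
        exact add_mem hp hq
      | monomial n a =>
        have := hmono n (a • m)
        rw [← smul_tmul, Polynomial.smul_eq_C_mul, Polynomial.C_mul_X_pow_eq_monomial] at this
        convert this using 3
        rw [← Polynomial.C_mul_X_pow_eq_monomial, ← Polynomial.smul_eq_C_mul, smul_assoc, smul_comm]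
  let E := TensorProduct.equivFinsuppOfBasisLeft (N := M) (Polynomial.basisMonomials R)
  have hE : ∀ (p : Polynomial R) (m : M) (n : ℕ), E (p ⊗ₜ m) n = p.coeff n • m := by
    intro p m n
    simp [E, Polynomial.basisMonomials]
    rfl
  have hE0 : ∀ x, E (f x) 0 = - ((Polynomial.X : Polynomial R) • E x 0) := by
    intro x
    induction x with
    | zero => simp
    | add x y hx hy => simp only [map_add, Finsupp.add_apply, hx, hy, smul_add, neg_add]
    | tmul p m =>
      rw [hf, map_sub, Finsupp.sub_apply, hE, hE, hE, Polynomial.mul_coeff_zero,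
        Polynomial.coeff_X_zero, zero_mul, zero_smul, zero_sub, ← hτ, ← hτ, map_smul]
  have hE1 : ∀ x n, E (f x) (n + 1) = E x n - (Polynomial.X : Polynomial R) • E x (n + 1) := by
    intro x n
    induction x with
    | zero => simp
    | add x y hx hy =>
      simp only [map_add, Finsupp.add_apply, hx, hy, smul_add]
      abel
    | tmul p m =>
      rw [hf, map_sub, Finsupp.sub_apply, hE, hE, hE, hE, Polynomial.coeff_X_mul, ← hτ, ← hτ,
        map_smul]
  have hinj : Function.Injective f := by
    rw [injective_iff_map_eq_zero]
    intro x hx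
    by_contra hne
    have hne' : E x ≠ 0 := by simpa using hne
    obtain ⟨n, hn⟩ := (E x).support.exists_max_image id (Finsupp.support_nonempty_iff.mpr hne')
    apply Finsupp.mem_support_iff.mp hn.1
    have h1 := hE1 x n
    have h2 : E x (n + 1) = 0 := by
      by_contra h3
      have := hn.2 (n + 1) (Finsupp.mem_support_iff.mpr h3)
      simp at this
    rw [hx, h2, map_zero, smul_zero, sub_zero] at h1
    exact h1.symm
  have hs : IsShortExact f g := by
    refine ⟨hinj, fun m => ⟨1 ⊗ₜ m, by rw [hg, one_smul]⟩, fun x => ⟨fun hx => ?_, ?_⟩⟩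
    · have := hcong x
      rwa [hx, tmul_zero, sub_zero] at this
    · rintro ⟨y, rfl⟩
      exact hgf y
  have h1 := (h M).baseChange (Polynomial R)
  exact hs.pdLT_right h1 (h1.mono (Nat.le_succ d))

theorem globalDimLT_mvPolynomial (k : Type) [Field k] (n : ℕ) :
    GlobalDimLT (MvPolynomial (Fin n) k) (n + 1) := by
  induction n with
  | zero =>
    have : GlobalDimLT k 1 := fun M _ _ => pdLT_one_of_free
    exact this.of_ringEquiv (isEmptyRingEquiv k (Fin 0)).symm
  | succ n ih => exact ih.polynomial.of_ringEquiv (finSuccEquiv k n).symm.toRingEquiv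

end GlobalDimension

/-! ### Quotients by colon ideals -/

section Colon

variable {R : Type} [CommRing R]

/-- Multiplication by `m` as a map `R/I'' → R/I`. -/
def mulQ (I I'' : Ideal R) (m : R) (h : ∀ f ∈ I'', m * f ∈ I) : (R ⧸ I'') →ₗ[R] (R ⧸ I) :=
  Submodule.mapQ I'' I (LinearMap.mulLeft R m) h

theorem mulQ_mk (I I'' : Ideal R) (m : R) (h : ∀ f ∈ I'', m * f ∈ I) (f : R) :
    mulQ I I'' m h (Submodule.Quotient.mk f) = Submodule.Quotient.mk (m * f) := rfl

theorem isShortExact_mulQ (I I' I'' : Ideal R) (m : R) (h : ∀ f ∈ I'', m * f ∈ I)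
    (h'' : ∀ f, m * f ∈ I → f ∈ I'') (hI : I ≤ I') (hm : m ∈ I')
    (h' : ∀ f ∈ I', ∃ q, f - m * q ∈ I) :
    IsShortExact (mulQ I I'' m h) (Submodule.factor hI) := by
  refine ⟨?_, Submodule.factor_surjective hI, ?_⟩
  · rw [injective_iff_map_eq_zero]
    intro x hx
    obtain ⟨f, rfl⟩ := Submodule.mkQ_surjective _ x
    rw [Submodule.mkQ_apply, Submodule.Quotient.mk_eq_zero]
    apply h''
    rwa [Submodule.mkQ_apply, mulQ_mk, Submodule.Quotient.mk_eq_zero] at hx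
  · intro x
    obtain ⟨f, rfl⟩ := Submodule.mkQ_surjective _ x
    rw [Submodule.factor_mk, Submodule.mkQ_apply, Submodule.mkQ_apply,
      Submodule.Quotient.mk_eq_zero]
    constructor
    · intro hf
      obtain ⟨q, hq⟩ := h' f hf
      refine ⟨Submodule.Quotient.mk q, ?_⟩
      rw [mulQ_mk, eq_comm, Submodule.Quotient.eq]
      exact hq
    · rintro ⟨y, hy⟩
      obtain ⟨q, rfl⟩ := Submodule.mkQ_surjective _ y
      rw [Submodule.mkQ_apply, mulQ_mk, eq_comm, Submodule.Quotient.eq] at hy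
      have := add_mem (hI hy) (I'.mul_mem_right q hm)
      rwa [sub_add_cancel] at this

end Colon

/-! ### Monomial ideals -/

section MonomialIdeals

variable (k : Type) [Field k] {n : ℕ}

/-- The monomial ideal with exponent set `U`. -/
noncomputable def monIdeal (U : UpperSet (Fin n →₀ ℕ)) : Ideal (MvPolynomial (Fin n) k) :=
  restrictSupportIdeal k (U : Set (Fin n →₀ ℕ)) U.upper

variable {k}

theorem mem_monIdeal {U : UpperSet (Fin n →₀ ℕ)} {f : MvPolynomial (Fin n) k} :
    f ∈ monIdeal k U ↔ ∀ a, a ∉ U → f.coeff a = 0 := by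
  change (↑f.support ⊆ (U : Set (Fin n →₀ ℕ))) ↔ _
  constructor
  · intro h a ha
    by_contra hne
    exact ha (h (by simpa using hne))
  · intro h a ha
    by_contra hne
    exact (by simpa using ha : f.coeff a ≠ 0) (h a hne)

theorem monomial_mem_monIdeal {U : UpperSet (Fin n →₀ ℕ)} {a : Fin n →₀ ℕ} :
    monomial a (1 : k) ∈ monIdeal k U ↔ a ∈ U := by
  classical
  rw [mem_monIdeal]
  constructor
  · intro h
    by_contra ha
    simpa using h a ha
  · intro h b hb
    rw [coeff_monomial, if_neg]
    rintro rfl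
    exact hb h

theorem monIdeal_le {U : UpperSet (Fin n →₀ ℕ)} {I : Ideal (MvPolynomial (Fin n) k)}
    (h : ∀ a ∈ U, monomial a (1 : k) ∈ I) : monIdeal k U ≤ I := by
  intro f hf
  rw [mem_monIdeal] at hf
  rw [f.as_sum]
  refine sum_mem fun a ha => ?_
  have : a ∈ U := by
    by_contra h'
    exact (mem_support_iff.mp ha) (hf a h')
  rw [show monomial a (coeff a f) = C (coeff a f) * monomial a 1 by rw [C_mul_monomial, mul_one]]
  exact I.mul_mem_left _ (h a this)

/-- The exponents of the colon ideal by a monomial. -/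
def colonU (U : UpperSet (Fin n →₀ ℕ)) (b : Fin n →₀ ℕ) : UpperSet (Fin n →₀ ℕ) :=
  ⟨{a | b + a ∈ U}, fun _ _ h ha => U.upper (add_le_add_right h b) ha⟩

/-- The exponents of the sum with the ideal generated by a monomial. -/
def addU (U : UpperSet (Fin n →₀ ℕ)) (b : Fin n →₀ ℕ) : UpperSet (Fin n →₀ ℕ) :=
  ⟨{a | a ∈ U ∨ b ≤ a}, fun _ _ h ha => ha.imp (U.upper h) (fun h' => h'.trans h)⟩

theorem mem_colonU {U : UpperSet (Fin n →₀ ℕ)} {a b : Fin n →₀ ℕ} :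
    a ∈ colonU U b ↔ b + a ∈ U := Iff.rfl

theorem mem_addU {U : UpperSet (Fin n →₀ ℕ)} {a b : Fin n →₀ ℕ} :
    a ∈ addU U b ↔ a ∈ U ∨ b ≤ a := Iff.rfl

theorem monomial_mul_mem_monIdeal {U : UpperSet (Fin n →₀ ℕ)} (b : Fin n →₀ ℕ)
    (f : MvPolynomial (Fin n) k) :
    monomial b 1 * f ∈ monIdeal k U ↔ f ∈ monIdeal k (colonU U b) := by
  simp only [mem_monIdeal]
  constructor
  · intro h a ha
    have := h (b + a) ha
    rwa [coeff_monomial_mul, one_mul] at this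
  · intro h a ha
    rw [coeff_monomial_mul']
    split_ifs with hb
    · rw [one_mul]
      apply h
      rwa [mem_colonU, add_tsub_cancel_of_le hb]
    · rfl

/-- The exact sequence `0 → S/(I : x^b) → S/I → S/(I + x^b) → 0` of monomial ideals. -/
theorem exists_isShortExact_colon {U V W : UpperSet (Fin n →₀ ℕ)} (b : Fin n →₀ ℕ)
    (hV : ∀ a, a ∈ V ↔ b + a ∈ U) (hW : ∀ a, a ∈ W ↔ a ∈ U ∨ b ≤ a) :
    ∃ (h : ∀ f ∈ monIdeal k V, monomial b 1 * f ∈ monIdeal k U)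
      (g : (MvPolynomial (Fin n) k ⧸ monIdeal k U) →ₗ[MvPolynomial (Fin n) k]
        (MvPolynomial (Fin n) k ⧸ monIdeal k W)),
      IsShortExact (mulQ _ _ (monomial b (1 : k)) h) g := by
  obtain rfl : V = colonU U b := SetLike.ext hV
  obtain rfl : W = addU U b := SetLike.ext hW
  refine ⟨fun f hf => (monomial_mul_mem_monIdeal b f).mpr hf, _,
    isShortExact_mulQ _ (monIdeal k (addU U b)) _ _ _
      (fun f hf => (monomial_mul_mem_monIdeal b f).mp hf) ?_ ?_ ?_⟩
  · intro f hf
    rw [mem_monIdeal] at hf ⊢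
    exact fun a ha => hf a fun h => ha (Or.inl h)
  · exact monomial_mem_monIdeal.mpr (Or.inr le_rfl)
  · intro f hf
    refine ⟨f.divMonomial b, ?_⟩
    rw [mem_monIdeal] at hf ⊢
    intro a ha
    rw [coeff_sub, coeff_monomial_mul', coeff_divMonomial]
    split_ifs with hb
    · rw [add_tsub_cancel_of_le hb, one_mul, sub_self]
    · rw [sub_zero]
      exact hf a fun h => h.elim ha hb

theorem pdLT_monIdeal (N : ℕ) (A : Finset (Fin n)) (U : UpperSet (Fin n →₀ ℕ))
    (hU : ∀ a b : Fin n →₀ ℕ, (∀ i ∈ A, min (a i) N = min (b i) N) → a ∈ U → b ∈ U) :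
    PdLT (MvPolynomial (Fin n) k) (MvPolynomial (Fin n) k ⧸ monIdeal k U) (A.card + 1) := by
  classical
  induction A using Finset.induction_on generalizing U with
  | empty =>
    by_cases h : ∃ a, a ∈ U
    · obtain ⟨a, ha⟩ := h
      have : monIdeal k U = ⊤ := by
        rw [Ideal.eq_top_iff_one, mem_monIdeal]
        exact fun b hb => (hb (hU a b (by simp) ha)).elim
      rw [this]
      exact pdLT_zero_of_subsingleton _
    · have : monIdeal k U = ⊥ := by
        rw [eq_bot_iff]
        intro f hf
        rw [mem_monIdeal] at hf
        ext a
        simpa using hf a fun ha => h ⟨a, ha⟩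
      rw [this]
      exact (pdLT_one_of_free (R := MvPolynomial (Fin n) k)
        (A := MvPolynomial (Fin n) k)).of_equiv (Submodule.quotEquivOfEqBot _ rfl).symm
  | insert v A hv ih =>
    rw [Finset.card_insert_of_notMem hv]
    have hcolon : ∀ m, ∀ a b : Fin n →₀ ℕ,
        (∀ i ∈ insert v A, min (a i) N = min (b i) N) →
        a ∈ colonU U (Finsupp.single v m) → b ∈ colonU U (Finsupp.single v m) := by
      intro m a b hab ha
      refine hU _ _ (fun i hi => ?_) ha
      have := hab i hi
      rw [Finsupp.add_apply, Finsupp.add_apply]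
      omega
    have htop : ∀ a b : Fin n →₀ ℕ, (∀ i ∈ A, min (a i) N = min (b i) N) →
        a ∈ colonU U (Finsupp.single v N) → b ∈ colonU U (Finsupp.single v N) := by
      intro a b hab ha
      refine hU _ _ (fun i hi => ?_) ha
      rw [Finsupp.add_apply, Finsupp.add_apply]
      rcases Finset.mem_insert.mp hi with rfl | hi
      · simp
      · have := hab i hi
        omega
    have main : ∀ j ≤ N, PdLT (MvPolynomial (Fin n) k)
        (MvPolynomial (Fin n) k ⧸ monIdeal k (colonU U (Finsupp.single v (N - j))))
        (A.card + 1 + 1) := by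
      intro j
      induction j with
      | zero => exact fun _ => (ih _ htop).mono (Nat.le_succ _)
      | succ j ihj =>
        intro hj
        have h1 := ihj (by omega)
        set m := N - (j + 1) with hm
        have hm' : N - j = m + 1 := by omega
        rw [hm'] at h1
        let T : UpperSet (Fin n →₀ ℕ) :=
          ⟨{a | a.erase v ∈ colonU U (Finsupp.single v m)}, by
            intro a b hab ha
            refine (colonU U (Finsupp.single v m)).upper (fun i => ?_) ha
            by_cases hi : i = v
            · simp [hi]
            · simpa [hi] using hab i⟩
        have hT : ∀ a, a ∈ T ↔ a.erase v ∈ colonU U (Finsupp.single v m) := fun _ => Iff.rfl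
        have hTA : ∀ a b : Fin n →₀ ℕ, (∀ i ∈ A, min (a i) N = min (b i) N) → a ∈ T → b ∈ T := by
          intro a b hab ha
          refine hcolon m _ _ (fun i hi => ?_) ha
          rcases Finset.mem_insert.mp hi with rfl | hi
          · simp
          · have hiv : i ≠ v := fun h => hv (h ▸ hi)
            rw [Finsupp.erase_ne hiv, Finsupp.erase_ne hiv]
            exact hab i hi
        have h2 := ih T hTA
        obtain ⟨_, _, hs⟩ := exists_isShortExact_colon (k := k) (U := T) (V := T)
          (W := addU T (Finsupp.single v 1)) (Finsupp.single v 1)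
          (fun a => by
            rw [hT, hT, Finsupp.erase_add, Finsupp.erase_single, zero_add])
          (fun a => Iff.rfl)
        have h3 := hs.pdLT_right h2 (h2.mono (Nat.le_succ _))
        obtain ⟨_, _, hs'⟩ := exists_isShortExact_colon (k := k)
          (U := colonU U (Finsupp.single v m)) (V := colonU U (Finsupp.single v (m + 1)))
          (W := addU T (Finsupp.single v 1)) (Finsupp.single v 1)
          (fun a => by
            rw [mem_colonU, mem_colonU, Finsupp.single_add, add_assoc])
          (fun a => by
            rw [mem_addU, hT]
            by_cases hav : Finsupp.single v 1 ≤ a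
            · simp [hav]
            · have : a v = 0 := by
                simpa [Finsupp.single_le_iff] using hav
              have : a.erase v = a := by
                ext i
                by_cases hi : i = v
                · rw [hi, Finsupp.erase_same, this]
                · rw [Finsupp.erase_ne hi]
              rw [this])
        exact hs'.pdLT_middle h1 h3
    have := main N le_rfl
    rw [Nat.sub_self, Finsupp.single_zero] at this
    have hU0 : colonU U 0 = U := SetLike.ext fun a => by rw [mem_colonU, zero_add]
    rwa [hU0] at this

end MonomialIdeals

/-! ### Powers of monomial primes and the symbolic powers -/

section SymbolicPowers

variable (k : Type) [Field k] {n : ℕ}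

/-- The degree of a monomial in the variables outside `F`. -/
def outDeg (F : Finset (Fin n)) (a : Fin n →₀ ℕ) : ℕ := ∑ i ∈ Fᶜ, a i

theorem outDeg_add (F : Finset (Fin n)) (a b : Fin n →₀ ℕ) :
    outDeg F (a + b) = outDeg F a + outDeg F b := Finset.sum_add_distrib

theorem outDeg_mono (F : Finset (Fin n)) {a b : Fin n →₀ ℕ} (h : a ≤ b) :
    outDeg F a ≤ outDeg F b := Finset.sum_le_sum fun i _ => h i

theorem outDeg_single (F : Finset (Fin n)) (i : Fin n) (m : ℕ) :
    outDeg F (Finsupp.single i m) = if i ∈ F then 0 else m := by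
  classical
  simp only [outDeg, Finsupp.single_apply, Finset.sum_ite_eq, Finset.mem_compl, ite_not]

/-- The exponents of the `ℓ`-th power of the monomial prime of `F`. -/
def powU (F : Finset (Fin n)) (ℓ : ℕ) : UpperSet (Fin n →₀ ℕ) :=
  ⟨{a | ℓ ≤ outDeg F a}, fun _ _ h ha => le_trans ha (outDeg_mono F h)⟩

theorem mem_powU {F : Finset (Fin n)} {ℓ : ℕ} {a : Fin n →₀ ℕ} :
    a ∈ powU F ℓ ↔ ℓ ≤ outDeg F a := Iff.rfl

/-- The prime ideal generated by the variables outside `F`. -/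
noncomputable def facePrime (F : Finset (Fin n)) : Ideal (MvPolynomial (Fin n) k) :=
  monIdeal k (powU F 1)

variable {k}

theorem X_mem_monIdeal {U : UpperSet (Fin n →₀ ℕ)} {i : Fin n} :
    (X i : MvPolynomial (Fin n) k) ∈ monIdeal k U ↔ Finsupp.single i 1 ∈ U :=
  monomial_mem_monIdeal

theorem X_mem_facePrime {F : Finset (Fin n)} {i : Fin n} :
    (X i : MvPolynomial (Fin n) k) ∈ facePrime k F ↔ i ∉ F := by
  rw [facePrime, X_mem_monIdeal, mem_powU, outDeg_single]
  split_ifs with h <;> simp [h]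

theorem exists_pos_of_outDeg_pos {F : Finset (Fin n)} {a : Fin n →₀ ℕ} (h : 1 ≤ outDeg F a) :
    ∃ i, i ∉ F ∧ Finsupp.single i 1 ≤ a := by
  obtain ⟨i, hi, h0⟩ := Finset.exists_ne_zero_of_sum_ne_zero (show outDeg F a ≠ 0 by omega)
  refine ⟨i, Finset.mem_compl.mp hi, ?_⟩
  rw [Finsupp.single_le_iff]
  omega

theorem facePrime_le {F : Finset (Fin n)} {Q : Ideal (MvPolynomial (Fin n) k)}
    (h : ∀ i, i ∉ F → X i ∈ Q) : facePrime k F ≤ Q := by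
  refine monIdeal_le fun a ha => ?_
  obtain ⟨i, hi, hle⟩ := exists_pos_of_outDeg_pos ha
  rw [← tsub_add_cancel_of_le hle, ← one_mul (1 : k), ← monomial_mul]
  exact Q.mul_mem_left _ (h i hi)

theorem facePrime_pow (F : Finset (Fin n)) (ℓ : ℕ) :
    facePrime k F ^ ℓ = monIdeal k (powU F ℓ) := by
  induction ℓ with
  | zero =>
    rw [pow_zero, Ideal.one_eq_top, eq_comm, Ideal.eq_top_iff_one, mem_monIdeal]
    exact fun a ha => (ha (Nat.zero_le _)).elim
  | succ ℓ ih =>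
    rw [pow_succ', ih]
    apply le_antisymm
    · rw [Ideal.mul_le]
      intro f hf g hg
      have : facePrime k F ≤ Submodule.colon (monIdeal k (powU F (ℓ + 1)))
          (monIdeal k (powU F ℓ) : Set (MvPolynomial (Fin n) k)) := by
        refine facePrime_le fun i hi => Submodule.mem_colon.mpr fun p hp => ?_
        rw [smul_eq_mul, X, monomial_mul_mem_monIdeal]
        rw [SetLike.mem_coe, mem_monIdeal] at hp
        rw [mem_monIdeal]
        intro a ha
        refine hp a fun ha' => ha ?_
        rw [mem_colonU, mem_powU, outDeg_add, outDeg_single, if_neg hi]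
        rw [mem_powU] at ha'
        omega
      exact Submodule.mem_colon.mp (this hf) g hg
    · refine monIdeal_le fun a ha => ?_
      rw [mem_powU] at ha
      obtain ⟨i, hi, hle⟩ := exists_pos_of_outDeg_pos (show 1 ≤ outDeg F a by omega)
      rw [← add_tsub_cancel_of_le hle, ← one_mul (1 : k), ← monomial_mul]
      refine Ideal.mul_mem_mul (X_mem_facePrime.mpr hi) (monomial_mem_monIdeal.mpr ?_)
      rw [← add_tsub_cancel_of_le hle, outDeg_add, outDeg_single, if_neg hi] at ha
      rw [mem_powU]
      omega

/-- The ring map recording the degree in the variables outside `F`. -/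
noncomputable def gradingMap (F : Finset (Fin n)) :
    MvPolynomial (Fin n) k →ₐ[k] Polynomial (MvPolynomial (Fin n) k) :=
  aeval fun i => if i ∈ F then Polynomial.C (X i) else Polynomial.monomial 1 (X i)

theorem gradingMap_monomial (F : Finset (Fin n)) (a : Fin n →₀ ℕ) (c : k) :
    gradingMap F (monomial a c) = Polynomial.monomial (outDeg F a) (monomial a c) := by
  induction a using Finsupp.induction_linear generalizing c with
  | zero =>
    rw [gradingMap, aeval_monomial, Finsupp.prod_zero_index, mul_one]
    simp [outDeg, Polynomial.monomial_zero_left]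
  | add a b ha hb =>
    rw [outDeg_add, ← mul_one c, ← monomial_mul, map_mul, ha, hb,
      Polynomial.monomial_mul_monomial]
  | single i m =>
    have hX : gradingMap F (X i : MvPolynomial (Fin n) k) =
        Polynomial.monomial (if i ∈ F then 0 else 1) (X i) := by
      rw [gradingMap, aeval_X]
      split_ifs <;> rfl
    have hm : (monomial (Finsupp.single i m) c : MvPolynomial (Fin n) k) = C c * X i ^ m := by
      rw [X_pow_eq_monomial, C_mul_monomial, mul_one]
    rw [hm, map_mul, map_pow, hX, Polynomial.monomial_pow, outDeg_single]
    have hC : gradingMap F (C c : MvPolynomial (Fin n) k) = Polynomial.C (C c) :=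
      (gradingMap (k := k) F).commutes c
    rw [hC, Polynomial.C_mul_monomial]
    congr 1
    split_ifs <;> simp

theorem coeff_gradingMap (F : Finset (Fin n)) (f : MvPolynomial (Fin n) k) (d : ℕ)
    (a : Fin n →₀ ℕ) :
    ((gradingMap F f).coeff d).coeff a = if outDeg F a = d then f.coeff a else 0 := by
  classical
  induction f using MvPolynomial.induction_on' with
  | monomial b c =>
    rw [gradingMap_monomial, Polynomial.coeff_monomial, coeff_monomial]
    by_cases hb : b = a
    · subst hb
      rw [if_pos rfl]
      split_ifs <;> simp
    · rw [if_neg hb]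
      split_ifs <;> simp [hb]
  | add p q hp hq =>
    rw [map_add, Polynomial.coeff_add, coeff_add, hp, hq, coeff_add]
    split_ifs <;> simp

theorem mem_monIdeal_powU_iff (F : Finset (Fin n)) (ℓ : ℕ) (f : MvPolynomial (Fin n) k) :
    f ∈ monIdeal k (powU F ℓ) ↔ Polynomial.X ^ ℓ ∣ gradingMap F f := by
  rw [mem_monIdeal, Polynomial.X_pow_dvd_iff]
  constructor
  · intro h d hd
    ext a
    rw [coeff_gradingMap, coeff_zero]
    split_ifs with ha
    · exact h a fun h' => by rw [mem_powU] at h'; omega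
    · rfl
  · intro h a ha
    have := congrArg (coeff a) (h (outDeg F a) (by rw [mem_powU] at ha; omega))
    rwa [coeff_gradingMap, if_pos rfl] at this

/-- Powers of monomial primes are primary. -/
theorem mem_monIdeal_powU_of_mul_mem {F : Finset (Fin n)} {ℓ : ℕ} {f g : MvPolynomial (Fin n) k}
    (hf : f ∉ facePrime k F) (h : f * g ∈ monIdeal k (powU F ℓ)) :
    g ∈ monIdeal k (powU F ℓ) := by
  rw [mem_monIdeal_powU_iff] at h ⊢
  rw [facePrime, mem_monIdeal_powU_iff, pow_one] at hf
  rw [map_mul] at h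
  exact Polynomial.prime_X.pow_dvd_of_dvd_mul_left ℓ hf h

theorem facePrime_isPrime (F : Finset (Fin n)) : (facePrime k F).IsPrime := by
  refine ⟨?_, fun {f g} h => ?_⟩
  · rw [Ne, Ideal.eq_top_iff_one, ← C_1, ← monomial_zero', facePrime, monomial_mem_monIdeal,
      mem_powU]
    simp [outDeg]
  · by_contra! h'
    exact h'.2 (mem_monIdeal_powU_of_mul_mem h'.1 h)

theorem exists_facet (K : Set (Finset (Fin n))) {G : Finset (Fin n)} (hG : G ∈ K) :
    ∃ F, IsFacet K F ∧ G ⊆ F := by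
  obtain ⟨F, hF, hmax⟩ := (Set.toFinite {F | F ∈ K ∧ G ⊆ F}).exists_le_maximal ⟨hG, le_rfl⟩
  refine ⟨F, ⟨hmax.prop.1, fun H hH hFH => ?_⟩, hF⟩
  exact (hmax.eq_of_le ⟨hH, hF.trans hFH⟩ hFH).symm

theorem prod_X_mem_iff_of_isPrime {Q : Ideal (MvPolynomial (Fin n) k)} (hQ : Q.IsPrime)
    (G : Finset (Fin n)) (m : ℕ) (h : ∏ i ∈ G, (X i : MvPolynomial (Fin n) k) ^ m ∈ Q) :
    ∃ i ∈ G, X i ∈ Q := by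
  obtain ⟨i, hi, h'⟩ := (hQ.prod_mem_iff).mp h
  exact ⟨i, hi, hQ.mem_of_pow_mem m h'⟩

/-- A prime containing all the products of powers over nonfaces contains a facet prime. -/
theorem exists_facePrime_le {K : Set (Finset (Fin n))} {Q : Ideal (MvPolynomial (Fin n) k)}
    (hQ : Q.IsPrime) (m : ℕ)
    (h : ∀ G, G ∉ K → ∏ i ∈ G, (X i : MvPolynomial (Fin n) k) ^ m ∈ Q) :
    ∃ F, IsFacet K F ∧ facePrime k F ≤ Q := by
  classical
  have hG : (Finset.univ.filter fun i => (X i : MvPolynomial (Fin n) k) ∉ Q) ∈ K := by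
    by_contra hG
    obtain ⟨i, hi, h'⟩ := prod_X_mem_iff_of_isPrime hQ _ m (h _ hG)
    exact (Finset.mem_filter.mp hi).2 h'
  obtain ⟨F, hF, hGF⟩ := exists_facet K hG
  refine ⟨F, hF, facePrime_le fun i hi => ?_⟩
  by_contra hX
  exact hi (hGF (by simpa using hX))

theorem srIdeal_le_facePrime {K : Set (Finset (Fin n))} (hK : IsComplex K) {F : Finset (Fin n)}
    (hF : F ∈ K) : srIdeal k K ≤ facePrime k F := by
  rw [srIdeal, Ideal.span_le]
  rintro _ ⟨G, hG, rfl⟩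
  have : ∃ i ∈ G, i ∉ F := by
    by_contra! h
    exact hG (hK.2 F hF G h)
  obtain ⟨i, hi, hiF⟩ := this
  exact (facePrime k F).mem_of_dvd (Finset.dvd_prod_of_mem _ hi) (X_mem_facePrime.mpr hiF)

theorem facePrime_le_iff {F G : Finset (Fin n)} : facePrime k F ≤ facePrime k G ↔ G ⊆ F := by
  constructor
  · intro h i hi
    by_contra hF
    exact X_mem_facePrime.mp (h (X_mem_facePrime.mpr hF)) hi
  · intro h
    exact facePrime_le fun i hi => X_mem_facePrime.mpr fun hG => hi (h hG)

theorem minimalPrimes_srIdeal {K : Set (Finset (Fin n))} (hK : IsComplex K) :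
    (srIdeal k K).minimalPrimes = facePrime k '' {F | IsFacet K F} := by
  have key : ∀ Q : Ideal (MvPolynomial (Fin n) k), Q.IsPrime → srIdeal k K ≤ Q →
      ∃ F, IsFacet K F ∧ facePrime k F ≤ Q := fun Q hQ hle =>
    exists_facePrime_le hQ 1 fun G hG => by
      simp only [pow_one]
      exact hle (Ideal.subset_span ⟨G, hG, rfl⟩)
  ext P
  constructor
  · intro hP
    obtain ⟨F, hF, hle⟩ := key P hP.1.1 hP.1.2
    exact ⟨F, hF, le_antisymm hle
      (hP.2 ⟨facePrime_isPrime F, srIdeal_le_facePrime hK hF.1⟩ hle)⟩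
  · rintro ⟨F, hF, rfl⟩
    refine ⟨⟨facePrime_isPrime F, srIdeal_le_facePrime hK hF.1⟩, fun Q hQ hle => ?_⟩
    obtain ⟨G, hG, hGQ⟩ := key Q hQ.1 hQ.2
    have hFG := facePrime_le_iff.mp (hGQ.trans hle)
    rw [hF.2 G hG.1 hFG] at hGQ
    exact hGQ

/-- The exponents of the `ℓ`-th symbolic power. -/
def symbU (K : Set (Finset (Fin n))) (ℓ : ℕ) : UpperSet (Fin n →₀ ℕ) :=
  ⟨{a | ∀ F, IsFacet K F → ℓ ≤ outDeg F a},
    fun _ _ h ha F hF => (ha F hF).trans (outDeg_mono F h)⟩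

theorem mem_symbU {K : Set (Finset (Fin n))} {ℓ : ℕ} {a : Fin n →₀ ℕ} :
    a ∈ symbU K ℓ ↔ ∀ F, IsFacet K F → ℓ ≤ outDeg F a := Iff.rfl

theorem mem_monIdeal_symbU {K : Set (Finset (Fin n))} {ℓ : ℕ} {f : MvPolynomial (Fin n) k} :
    f ∈ monIdeal k (symbU K ℓ) ↔ ∀ F, IsFacet K F → f ∈ monIdeal k (powU F ℓ) := by
  simp only [mem_monIdeal, mem_symbU, mem_powU]
  constructor
  · exact fun h F hF a ha => h a fun h' => ha (h' F hF)
  · intro h a ha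
    push Not at ha
    obtain ⟨F, hF, hlt⟩ := ha
    exact h F hF a (by omega)

theorem symbPow_srIdeal {K : Set (Finset (Fin n))} (hK : IsComplex K) (ℓ : ℕ) :
    symbPow (srIdeal k K) ℓ = monIdeal k (symbU K ℓ) := by
  ext f
  rw [symbPow, minimalPrimes_srIdeal hK, mem_monIdeal_symbU, Submodule.mem_sInf]
  constructor
  · intro h F hF
    have := h _ ⟨_, ⟨F, hF, rfl⟩, rfl⟩
    rwa [facePrime_pow] at this
  · rintro h _ ⟨_, ⟨F, hF, rfl⟩, rfl⟩
    rw [facePrime_pow]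
    exact h F hF

end SymbolicPowers

open Abelian

/-! ### Socles and `Ext` from the residue field -/

section Residue

variable {k : Type} [Field k] {n : ℕ} {N : Type} [AddCommGroup N]
  [Module (MvPolynomial (Fin n) k) N]

variable (k n) in
theorem maxIdeal_eq_facePrime : maxIdeal k (Fin n) = facePrime k ∅ := by
  apply le_antisymm
  · rw [maxIdeal, Ideal.span_le]
    rintro _ ⟨i, rfl⟩
    exact X_mem_facePrime.mpr (Finset.notMem_empty i)
  · exact facePrime_le fun i _ => Ideal.subset_span ⟨i, rfl⟩

theorem X_mem_maxIdeal (i : Fin n) : (X i : MvPolynomial (Fin n) k) ∈ maxIdeal k (Fin n) :=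
  Ideal.subset_span ⟨i, rfl⟩

theorem sub_C_mem_maxIdeal (f : MvPolynomial (Fin n) k) :
    f - C (f.coeff 0) ∈ maxIdeal k (Fin n) := by
  classical
  rw [maxIdeal_eq_facePrime, facePrime, mem_monIdeal]
  intro a ha
  have ha : a = 0 := by
    ext i
    have h : outDeg ∅ a = 0 := by
      rw [mem_powU] at ha
      omega
    exact (Finset.sum_eq_zero_iff.mp h) i (by simp)
  simp [ha]

variable (k n) in
/-- The residue field of the polynomial ring at the origin. -/
abbrev ResField : Type := MvPolynomial (Fin n) k ⧸ maxIdeal k (Fin n)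

theorem exists_residue_map (z : N) (hz : ∀ i, (X i : MvPolynomial (Fin n) k) • z = 0) :
    ∃ f : ResField k n →ₗ[MvPolynomial (Fin n) k] N,
      f (Submodule.Quotient.mk 1) = z ∧ (z ≠ 0 → Function.Injective f) := by
  have hle : maxIdeal k (Fin n) ≤
      LinearMap.ker (LinearMap.toSpanSingleton (MvPolynomial (Fin n) k) N z) := by
    rw [maxIdeal, Ideal.span_le]
    rintro _ ⟨i, rfl⟩
    exact hz i
  refine ⟨Submodule.liftQ _ _ hle, one_smul _ z, fun hne => ?_⟩
  rw [injective_iff_map_eq_zero]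
  intro x hx
  obtain ⟨f, rfl⟩ := Submodule.mkQ_surjective _ x
  rw [Submodule.mkQ_apply, Submodule.Quotient.mk_eq_zero]
  have hx' : f • z = 0 := hx
  have h1 : (f - C (f.coeff 0)) • z = 0 := hle (sub_C_mem_maxIdeal f)
  have h2 : (C (f.coeff 0) : MvPolynomial (Fin n) k) • z = 0 := by
    rwa [sub_smul, hx', zero_sub, neg_eq_zero] at h1
  have h3 : f.coeff 0 = 0 := by
    by_contra h0
    apply hne
    have := congrArg ((C (f.coeff 0)⁻¹ : MvPolynomial (Fin n) k) • ·) h2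
    simpa [smul_smul, ← C_mul, inv_mul_cancel₀ h0] using this
  have h4 := sub_C_mem_maxIdeal f
  rwa [h3, C_0, sub_zero] at h4

theorem extZero_residue_zero_iff :
    ExtZero (MvPolynomial (Fin n) k) (ResField k n) N 0 ↔
      ∀ z : N, (∀ i, (X i : MvPolynomial (Fin n) k) • z = 0) → z = 0 := by
  rw [extZero_zero_iff]
  constructor
  · intro h z hz
    obtain ⟨f, hf, _⟩ := exists_residue_map z hz
    rw [← hf, h f, LinearMap.zero_apply]
  · intro h f
    have h1 : f (Submodule.Quotient.mk 1) = 0 := by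
      refine h _ fun i => ?_
      rw [← map_smul, ← Submodule.Quotient.mk_smul, smul_eq_mul, mul_one,
        (Submodule.Quotient.mk_eq_zero _).mpr (X_mem_maxIdeal i), map_zero]
    refine LinearMap.ext fun x => ?_
    obtain ⟨g, rfl⟩ := Submodule.mkQ_surjective _ x
    rw [Submodule.mkQ_apply, ← mul_one g, ← smul_eq_mul, Submodule.Quotient.mk_smul, map_smul, h1,
      smul_zero, LinearMap.zero_apply]

/-- A nonzero element supported at the origin has a nonzero socle element among its multiples. -/
theorem exists_socle (z : N) (hz : z ≠ 0)
    (h : ∀ Q : Ideal (MvPolynomial (Fin n) k), Q.IsPrime → (∀ r, r • z = 0 → r ∈ Q) →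
      ∀ i, X i ∈ Q) :
    ∃ z' : N, z' ≠ 0 ∧ ∀ i, (X i : MvPolynomial (Fin n) k) • z' = 0 := by
  let I : Ideal (MvPolynomial (Fin n) k) :=
    LinearMap.ker (LinearMap.toSpanSingleton (MvPolynomial (Fin n) k) N z)
  have hI : ∀ r, r ∈ I ↔ r • z = 0 := fun r => Iff.rfl
  have hrad : maxIdeal k (Fin n) ≤ I.radical := by
    rw [Ideal.radical_eq_sInf, maxIdeal, Ideal.span_le]
    rintro _ ⟨i, rfl⟩
    rw [SetLike.mem_coe, Submodule.mem_sInf]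
    exact fun Q hQ => h Q hQ.2 (fun r hr => hQ.1 hr) i
  have hex : ∃ t, maxIdeal k (Fin n) ^ t ≤ I :=
    Ideal.exists_pow_le_of_le_radical_of_fg hrad (IsNoetherian.noetherian _)
  classical
  have hmin := fun t => Nat.find_min (m := t) hex
  have hfind := Nat.find_spec hex
  rcases ht : Nat.find hex with _ | t
  · rw [ht, pow_zero, Ideal.one_eq_top] at hfind
    exact (hz (by simpa using (hI 1).mp (hfind trivial))).elim
  · have := hmin t (by omega)
    obtain ⟨r, hr, hrI⟩ := Set.not_subset.mp this
    refine ⟨r • z, hrI, fun i => ?_⟩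
    rw [← mul_smul]
    apply hfind
    rw [ht, pow_succ']
    exact Ideal.mul_mem_mul (X_mem_maxIdeal i) hr

theorem smul_ext_residue_eq_zero {i : ℕ} {r : MvPolynomial (Fin n) k}
    (hr : r ∈ maxIdeal k (Fin n)) :
    ExtKill (MvPolynomial (Fin n) k) r (ResField k n) N i := by
  intro e
  have h0 : r • 𝟙 (ModuleCat.of (MvPolynomial (Fin n) k) (ResField k n)) = 0 := by
    ext
    change r • (Submodule.Quotient.mk 1 : ResField k n) = 0
    rw [← Submodule.Quotient.mk_smul, smul_eq_mul, mul_one]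
    exact (Submodule.Quotient.mk_eq_zero _).mpr hr
  have h1 := Ext.smul_comp (Ext.mk₀ (𝟙 (ModuleCat.of (MvPolynomial (Fin n) k) (ResField k n)))) e
    (zero_add i) r
  rw [Ext.mk₀_id_comp, ← Ext.mk₀_smul] at h1
  rw [← h1]
  erw [h0, Ext.mk₀_zero, Ext.zero_comp]

theorem extZero_residue_one {C : Type} [AddCommGroup C] [Module (MvPolynomial (Fin n) k) C]
    {r : MvPolynomial (Fin n) k} (hr : r ∈ maxIdeal k (Fin n))
    {f : N →ₗ[MvPolynomial (Fin n) k] N} {g : N →ₗ[MvPolynomial (Fin n) k] C}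
    (h : IsShortExact f g) (hf : ∀ z, f z = r • z)
    (hC : ExtZero (MvPolynomial (Fin n) k) (ResField k n) C 0) :
    ExtZero (MvPolynomial (Fin n) k) (ResField k n) N 1 := by
  intro e
  have hfe : ModuleCat.ofHom f = r • 𝟙 (ModuleCat.of (MvPolynomial (Fin n) k) N) := by
    ext z
    exact hf z
  have h0 : e.comp (Ext.mk₀ (ModuleCat.ofHom f)) (add_zero 1) = 0 := by
    rw [hfe, ← Ext.smul_eq_comp_mk₀]
    exact smul_ext_residue_eq_zero hr e
  obtain ⟨e', rfl⟩ := Ext.covariant_sequence_exact₁ _ h.shortExact e h0 rfl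
  rw [hC e', Ext.zero_comp]

end Residue

section MonomialExt

variable {k : Type} [Field k] {n : ℕ}

theorem extZero_residue_monIdeal_zero {U : UpperSet (Fin n →₀ ℕ)} {u : Fin n}
    (hu : ∀ a, Finsupp.single u 1 + a ∈ U → a ∈ U) :
    ExtZero (MvPolynomial (Fin n) k) (ResField k n) (MvPolynomial (Fin n) k ⧸ monIdeal k U) 0 := by
  rw [extZero_residue_zero_iff]
  intro z hz
  obtain ⟨f, rfl⟩ := Submodule.mkQ_surjective _ z
  have h := hz u
  rw [Submodule.mkQ_apply, ← Submodule.Quotient.mk_smul, Submodule.Quotient.mk_eq_zero,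
    smul_eq_mul, X, monomial_mul_mem_monIdeal, mem_monIdeal] at h
  rw [Submodule.mkQ_apply, Submodule.Quotient.mk_eq_zero, mem_monIdeal]
  exact fun a ha => h a fun h' => ha (hu a h')

theorem extZero_residue_monIdeal_one {U : UpperSet (Fin n →₀ ℕ)} {u v : Fin n} (huv : u ≠ v)
    (hu : ∀ a, Finsupp.single u 1 + a ∈ U → a ∈ U)
    (hv : ∀ a, Finsupp.single v 1 + a ∈ U → a ∈ U) :
    ExtZero (MvPolynomial (Fin n) k) (ResField k n) (MvPolynomial (Fin n) k ⧸ monIdeal k U) 1 := by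
  obtain ⟨_, _, hs⟩ := exists_isShortExact_colon (k := k) (U := U) (V := U)
    (W := addU U (Finsupp.single u 1)) (Finsupp.single u 1)
    (fun a => ⟨fun h => U.upper (le_add_of_nonneg_left zero_le) h, hu a⟩) (fun a => Iff.rfl)
  refine extZero_residue_one (X_mem_maxIdeal u) hs (fun z => ?_)
    (extZero_residue_monIdeal_zero (u := v) fun a => ?_)
  · obtain ⟨f, rfl⟩ := Submodule.mkQ_surjective _ z
    rfl
  · rw [mem_addU, mem_addU]
    refine Or.imp (hv a) fun h => ?_
    rw [Finsupp.single_le_iff] at h ⊢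
    rwa [Finsupp.add_apply, Finsupp.single_eq_of_ne huv, zero_add] at h

theorem powU_cancel {F : Finset (Fin n)} {ℓ : ℕ} {u : Fin n} (hu : u ∈ F) (a : Fin n →₀ ℕ)
    (h : Finsupp.single u 1 + a ∈ powU F ℓ) : a ∈ powU F ℓ := by
  rwa [mem_powU, outDeg_add, outDeg_single, if_pos hu, zero_add] at h

theorem powU_congr {F : Finset (Fin n)} {ℓ : ℕ} {a b : Fin n →₀ ℕ}
    (hab : ∀ i ∉ F, min (a i) ℓ = min (b i) ℓ) (ha : a ∈ powU F ℓ) : b ∈ powU F ℓ := by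
  rw [mem_powU] at *
  by_cases h : ∃ i, i ∉ F ∧ ℓ ≤ a i
  · obtain ⟨i, hi, hle⟩ := h
    have h1 := hab i hi
    have h2 : b i ≤ outDeg F b :=
      Finset.single_le_sum (f := fun j => b j) (fun _ _ => Nat.zero_le _) (Finset.mem_compl.mpr hi)
    omega
  · push Not at h
    have : outDeg F a ≤ outDeg F b := Finset.sum_le_sum fun i hi => by
      have h1 := hab i (Finset.mem_compl.mp hi)
      have h2 := h i (Finset.mem_compl.mp hi)
      omega
    omega

theorem pdLT_powU (F : Finset (Fin n)) (ℓ : ℕ) :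
    PdLT (MvPolynomial (Fin n) k) (MvPolynomial (Fin n) k ⧸ monIdeal k (powU F ℓ))
      (n - F.card + 1) := by
  have := pdLT_monIdeal (k := k) ℓ Fᶜ (powU F ℓ) fun a b hab ha =>
    powU_congr (fun i hi => hab i (Finset.mem_compl.mpr hi)) ha
  rwa [Finset.card_compl, Fintype.card_fin] at this

/-- The exponents of the sum of the powers of two monomial primes. -/
def sumU (F G : Finset (Fin n)) (ℓ : ℕ) : UpperSet (Fin n →₀ ℕ) :=
  ⟨{a | a ∈ powU F ℓ ∨ a ∈ powU G ℓ}, fun _ _ h ha =>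
    ha.imp ((powU F ℓ).upper h) ((powU G ℓ).upper h)⟩

theorem mem_sumU {F G : Finset (Fin n)} {ℓ : ℕ} {a : Fin n →₀ ℕ} :
    a ∈ sumU F G ℓ ↔ a ∈ powU F ℓ ∨ a ∈ powU G ℓ := Iff.rfl

theorem pdLT_sumU (F G : Finset (Fin n)) (ℓ : ℕ) :
    PdLT (MvPolynomial (Fin n) k) (MvPolynomial (Fin n) k ⧸ monIdeal k (sumU F G ℓ))
      (n - (F ∩ G).card + 1) := by
  have := pdLT_monIdeal (k := k) ℓ (F ∩ G)ᶜ (sumU F G ℓ) fun a b hab ha =>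
    ha.imp (powU_congr fun i hi => hab i (by simp [hi]))
      (powU_congr fun i hi => hab i (by simp [hi]))
  rwa [Finset.card_compl, Fintype.card_fin] at this

/-- `Ext^d(M, Y)` is cyclic with annihilator `I`. -/
def HasExtGenerator (R : Type) [CommRing R] (M Y : Type) [AddCommGroup M] [Module R M]
    [AddCommGroup Y] [Module R Y] (d : ℕ) (I : Ideal R) : Prop :=
  ∃ e : Abelian.Ext (ModuleCat.of R M) (ModuleCat.of R Y) d,
    (∀ e', ∃ r : R, e' = r • e) ∧ ∀ r : R, r • e = 0 ↔ r ∈ I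

theorem IsShortExact.hasExtGenerator {R : Type} [CommRing R] {B C Y : Type}
    [AddCommGroup B] [Module R B] [AddCommGroup C] [Module R C] [AddCommGroup Y] [Module R Y]
    {f : B →ₗ[R] B} {g : B →ₗ[R] C} (hs : IsShortExact f g) {x : R} (hf : ∀ z, f z = x • z)
    {d : ℕ} {I J : Ideal R} (hB : HasExtGenerator R B Y d I) (hB' : ExtZero R B Y (d + 1))
    (hJ : ∀ r, r ∈ J ↔ ∃ t, r - t * x ∈ I) : HasExtGenerator R C Y (d + 1) J := by
  obtain ⟨e, hgen, hann⟩ := hB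
  have hmul : ∀ s : Abelian.Ext (ModuleCat.of R B) (ModuleCat.of R Y) d,
      (Ext.mk₀ (ModuleCat.ofHom f)).comp s (zero_add _) = x • s := by
    intro s
    have hfe : ModuleCat.ofHom f = x • 𝟙 (ModuleCat.of R B) := by
      ext z
      exact hf z
    rw [hfe, Ext.mk₀_smul, Ext.smul_comp, Ext.mk₀_id_comp]
  refine ⟨hs.shortExact.extClass.comp e (add_comm _ _), fun e' => ?_, fun r => ?_⟩
  · obtain ⟨s, rfl⟩ := Ext.contravariant_sequence_exact₃ hs.shortExact
      (ModuleCat.of R Y) e' (hB' _) (add_comm _ _)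
    obtain ⟨r, rfl⟩ := hgen s
    exact ⟨r, Ext.comp_smul _ _ _ _⟩
  · have hsmul := Ext.comp_smul hs.shortExact.extClass e (add_comm 1 d) r
    rw [hJ]
    constructor
    · intro h0
      obtain ⟨s, hs'⟩ := Ext.contravariant_sequence_exact₁ hs.shortExact
        (ModuleCat.of R Y) (r • e) (add_comm _ _) (hsmul.trans h0)
      obtain ⟨t, rfl⟩ := hgen s
      have h2 := (hmul (t • e)).symm.trans hs'
      rw [smul_smul, eq_comm, ← sub_eq_zero, ← sub_smul, hann, mul_comm] at h2
      exact ⟨t, h2⟩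
    · rintro ⟨t, ht⟩
      have h2 : r • e = (Ext.mk₀ (ModuleCat.ofHom f)).comp (t • e) (zero_add _) := by
        rw [hmul, smul_smul, ← sub_eq_zero, ← sub_smul, hann, mul_comm]
        exact ht
      refine hsmul.symm.trans ?_
      rw [h2]
      exact hs.shortExact.extClass_comp_assoc _

/-- The top `Ext` of a monomial prime into the polynomial ring is cyclic, with annihilator the
prime itself. -/
theorem hasExtGenerator_facePrime (A : Finset (Fin n)) :
    HasExtGenerator (MvPolynomial (Fin n) k) (MvPolynomial (Fin n) k ⧸ facePrime k Aᶜ)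
      (MvPolynomial (Fin n) k) A.card (facePrime k Aᶜ) := by
  induction A using Finset.induction_on with
  | empty =>
    rw [Finset.card_empty]
    have hbot : facePrime k (∅ : Finset (Fin n))ᶜ = ⊥ :=
      eq_bot_iff.mpr (facePrime_le fun i hi => by simp at hi)
    rw [hbot]
    let φ : (MvPolynomial (Fin n) k ⧸ (⊥ : Ideal (MvPolynomial (Fin n) k)))
      ≃ₗ[MvPolynomial (Fin n) k] MvPolynomial (Fin n) k := Submodule.quotEquivOfEqBot _ rfl
    have hφ : ∀ f : MvPolynomial (Fin n) k, φ (Submodule.Quotient.mk f) = f := fun f =>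
      Submodule.quotEquivOfEqBot_apply_mk _ rfl f
    have hmk : ∀ (r : MvPolynomial (Fin n) k), r • Ext.mk₀ (ModuleCat.ofHom φ.toLinearMap) =
        Ext.mk₀ (ModuleCat.ofHom (r • φ.toLinearMap)) := fun r => (Ext.mk₀_smul r _).symm
    refine ⟨Ext.mk₀ (ModuleCat.ofHom φ.toLinearMap), fun e' => ?_, fun r => ?_⟩
    · obtain ⟨ψ, rfl⟩ := Ext.homEquiv₀.symm.surjective e'
      refine ⟨ψ.hom (Submodule.Quotient.mk 1), ?_⟩
      rw [Ext.homEquiv₀_symm_apply, hmk]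
      congr 1
      refine ModuleCat.hom_ext (Submodule.linearMap_qext _ (LinearMap.ext_ring ?_))
      change ψ.hom (Submodule.Quotient.mk 1) = ψ.hom (Submodule.Quotient.mk 1) *
        φ (Submodule.Quotient.mk 1)
      rw [hφ, mul_one]
    · rw [hmk, Ext.mk₀_eq_zero_iff, Ideal.mem_bot]
      constructor
      · intro h
        have h1 := LinearMap.congr_fun (congrArg ModuleCat.Hom.hom h) (Submodule.Quotient.mk 1)
        change r * φ (Submodule.Quotient.mk 1) = 0 at h1
        rwa [hφ, mul_one] at h1
      · rintro rfl
        rw [zero_smul]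
        rfl
  | insert v A hv ih =>
    have hvA : v ∈ Aᶜ := Finset.mem_compl.mpr hv
    obtain ⟨h, g, hs⟩ := exists_isShortExact_colon (k := k) (U := powU Aᶜ 1) (V := powU Aᶜ 1)
      (W := powU (insert v A)ᶜ 1) (Finsupp.single v 1)
      (fun a => ⟨fun h => (powU Aᶜ 1).upper (le_add_of_nonneg_left zero_le) h,
        powU_cancel hvA a⟩)
      (fun a => by
        rw [mem_powU, mem_powU, Finsupp.single_le_iff, outDeg, outDeg, compl_compl, compl_compl,
          Finset.sum_insert hv]
        omega)
    have hpd := (pdLT_powU (k := k) Aᶜ 1).extZero (Y := MvPolynomial (Fin n) k)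
      (i := A.card + 1) (by
        rw [Finset.card_compl, Fintype.card_fin]
        have := Finset.card_le_univ A
        rw [Fintype.card_fin] at this
        omega)
    rw [Finset.card_insert_of_notMem hv]
    refine hs.hasExtGenerator (x := X v) (fun z => ?_) ih hpd fun r => ?_
    · obtain ⟨f, rfl⟩ := Submodule.mkQ_surjective _ z
      rfl
    · have hle : facePrime k Aᶜ ≤ facePrime k (insert v A)ᶜ :=
        facePrime_le_iff.mpr (Finset.compl_subset_compl.mpr (Finset.subset_insert v A))
      have hXv : (X v : MvPolynomial (Fin n) k) ∈ facePrime k (insert v A)ᶜ :=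
        X_mem_facePrime.mpr (by simp)
      constructor
      · intro hr
        have hle' : facePrime k (insert v A)ᶜ ≤ facePrime k Aᶜ ⊔ Ideal.span {X v} := by
          refine facePrime_le fun i hi => ?_
          by_cases hiv : i = v
          · exact hiv ▸ Ideal.mem_sup_right (Ideal.mem_span_singleton_self _)
          · exact Ideal.mem_sup_left (X_mem_facePrime.mpr (by simpa [hiv] using hi))
        obtain ⟨p, hp, q, hq, rfl⟩ := Submodule.mem_sup.mp (hle' hr)
        obtain ⟨t, rfl⟩ := Ideal.mem_span_singleton'.mp hq
        exact ⟨t, by rwa [add_sub_cancel_right]⟩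
      · rintro ⟨t, ht⟩
        have := add_mem (hle ht) (Ideal.mul_mem_left _ t hXv)
        rwa [sub_add_cancel] at this

theorem mem_facePrime_of_extKill {F : Finset (Fin n)} {r : MvPolynomial (Fin n) k}
    (h : ExtKill (MvPolynomial (Fin n) k) r (MvPolynomial (Fin n) k ⧸ facePrime k F)
      (MvPolynomial (Fin n) k) (n - F.card)) : r ∈ facePrime k F := by
  have hg := hasExtGenerator_facePrime (k := k) Fᶜ
  rw [compl_compl, Finset.card_compl, Fintype.card_fin] at hg
  obtain ⟨e, -, he⟩ := hg
  exact (he r).mp (h e)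

end MonomialExt

open Abelian

/-! ### `Ext` and finite products -/

section FiniteProducts

variable {R : Type} [CommRing R] {ι : Type} [Finite ι] {A : ι → Type} [∀ i, AddCommGroup (A i)]
  [∀ i, Module R (A i)] {X : Type} [AddCommGroup X] [Module R X] {j : ℕ}

theorem id_pi_eq_sum [Fintype ι] [DecidableEq ι] : 𝟙 (ModuleCat.of R (∀ i, A i)) =
    ∑ i, ModuleCat.ofHom (LinearMap.proj i) ≫ ModuleCat.ofHom (LinearMap.single R A i) := by
  ext z i
  simp [ModuleCat.hom_sum, Finset.sum_apply]

theorem extZero_pi_right (h : ∀ i, ExtZero R X (A i) j) : ExtZero R X (∀ i, A i) j := by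
  classical
  have := Fintype.ofFinite ι
  intro e
  rw [← e.comp_mk₀_id, id_pi_eq_sum, Ext.mk₀_sum, Ext.comp_sum]
  refine Finset.sum_eq_zero fun i _ => ?_
  rw [← Ext.mk₀_comp_mk₀, ← Ext.comp_assoc_of_second_deg_zero, h i (e.comp _ _), Ext.zero_comp]

theorem extZero_pi_left (h : ∀ i, ExtZero R (A i) X j) : ExtZero R (∀ i, A i) X j := by
  classical
  have := Fintype.ofFinite ι
  intro e
  rw [← e.mk₀_id_comp, id_pi_eq_sum, Ext.mk₀_sum, Ext.sum_comp]
  refine Finset.sum_eq_zero fun i _ => ?_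
  rw [← Ext.mk₀_comp_mk₀_assoc, h i ((Ext.mk₀ _).comp e _), Ext.comp_zero]

end FiniteProducts

/-! ### The quotient by a symbolic power and its embedding into the local pieces -/

section SymbolicQuotient

variable (k : Type) [Field k] {n : ℕ} (K : Set (Finset (Fin n))) (ℓ : ℕ)

/-- The quotient of the polynomial ring by the `ℓ`-th symbolic power of `srIdeal k K`. -/
abbrev SymbQuot : Type := MvPolynomial (Fin n) k ⧸ monIdeal k (symbU K ℓ)

/-- The product over the facets of the quotients by powers of the facet primes. -/
abbrev FacetProd : Type :=
  ∀ F : {F : Finset (Fin n) // IsFacet K F}, MvPolynomial (Fin n) k ⧸ monIdeal k (powU F.1 ℓ)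

/-- The diagonal map into the product over the facets. -/
noncomputable def toFacetProd : SymbQuot k K ℓ →ₗ[MvPolynomial (Fin n) k] FacetProd k K ℓ :=
  Submodule.liftQ _ (LinearMap.pi fun F => Submodule.mkQ (monIdeal k (powU F.1 ℓ))) fun f hf => by
    rw [LinearMap.mem_ker]
    ext1 F
    exact (Submodule.Quotient.mk_eq_zero _).mpr (mem_monIdeal_symbU.mp hf F.1 F.2)

theorem toFacetProd_mk (f : MvPolynomial (Fin n) k) (F : {F : Finset (Fin n) // IsFacet K F}) :
    toFacetProd k K ℓ (Submodule.Quotient.mk f) F = Submodule.Quotient.mk f := rfl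

theorem toFacetProd_injective : Function.Injective (toFacetProd k K ℓ) := by
  rw [injective_iff_map_eq_zero]
  intro z hz
  obtain ⟨f, rfl⟩ := Submodule.mkQ_surjective _ z
  rw [Submodule.mkQ_apply, Submodule.Quotient.mk_eq_zero, mem_monIdeal_symbU]
  exact fun F hF => (Submodule.Quotient.mk_eq_zero _).mp (congrFun hz ⟨F, hF⟩)

/-- The cokernel of the diagonal map. -/
abbrev FacetCoker : Type := FacetProd k K ℓ ⧸ LinearMap.range (toFacetProd k K ℓ)

theorem isShortExact_toFacetProd :
    IsShortExact (toFacetProd k K ℓ) (LinearMap.range (toFacetProd k K ℓ)).mkQ :=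
  isShortExact_mkQ_range _ (toFacetProd_injective k K ℓ)

variable {K}

theorem extZero_residue_facetProd_zero (hne : ∀ F, IsFacet K F → F.Nonempty) :
    ExtZero (MvPolynomial (Fin n) k) (ResField k n) (FacetProd k K ℓ) 0 :=
  extZero_pi_right fun F => (hne F.1 F.2).elim fun _ hu =>
    extZero_residue_monIdeal_zero (powU_cancel hu)

theorem extZero_residue_symbQuot_zero (hne : ∀ F, IsFacet K F → F.Nonempty) :
    ExtZero (MvPolynomial (Fin n) k) (ResField k n) (SymbQuot k K ℓ) 0 :=
  (extZero_residue_facetProd_zero k ℓ hne).of_injective _ (toFacetProd_injective k K ℓ)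

theorem extZero_facetProd_top (hne : ∀ F, IsFacet K F → F.Nonempty) :
    ExtZero (MvPolynomial (Fin n) k) (FacetProd k K ℓ) (MvPolynomial (Fin n) k) n :=
  extZero_pi_left fun F => (pdLT_powU F.1 ℓ).extZero (by
    have h1 := (hne F.1 F.2).card_pos
    have h2 := Finset.card_le_univ F.1
    rw [Fintype.card_fin] at h2
    omega)

theorem extZero_symbQuot_top (hne : ∀ F, IsFacet K F → F.Nonempty) :
    ExtZero (MvPolynomial (Fin n) k) (SymbQuot k K ℓ) (MvPolynomial (Fin n) k) n :=
  (isShortExact_toFacetProd k K ℓ).ext'_left (extZero_facetProd_top k ℓ hne)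
    ((globalDimLT_mvPolynomial k n _).extZero le_rfl)

theorem sum_X_notMem_facePrime {F : Finset (Fin n)} (hF : F.Nonempty) :
    ∑ i, (X i : MvPolynomial (Fin n) k) ∉ facePrime k F := by
  classical
  obtain ⟨u, hu⟩ := hF
  intro h
  have := mem_monIdeal.mp h (Finsupp.single u 1) (by rw [mem_powU, outDeg_single, if_pos hu]; simp)
  rw [coeff_sum, Finset.sum_eq_single u] at this
  · simp at this
  · intro v _ hv
    rw [coeff_X, if_neg]
    exact fun h => hv ((Finsupp.single_left_inj one_ne_zero).mp h)
  · simp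

theorem sum_X_smul_injective (hne : ∀ F, IsFacet K F → F.Nonempty) :
    Function.Injective ((∑ i, (X i : MvPolynomial (Fin n) k)) •
      (LinearMap.id : SymbQuot k K ℓ →ₗ[MvPolynomial (Fin n) k] SymbQuot k K ℓ)) := by
  rw [injective_iff_map_eq_zero]
  intro z hz
  obtain ⟨f, rfl⟩ := Submodule.mkQ_surjective _ z
  rw [LinearMap.smul_apply, LinearMap.id_apply, Submodule.mkQ_apply, ← Submodule.Quotient.mk_smul,
    Submodule.Quotient.mk_eq_zero, mem_monIdeal_symbU] at hz
  rw [Submodule.mkQ_apply, Submodule.Quotient.mk_eq_zero, mem_monIdeal_symbU]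
  exact fun F hF =>
    mem_monIdeal_powU_of_mul_mem (sum_X_notMem_facePrime k (hne F hF)) (hz F hF)

theorem prod_X_pow_mem_symbQuot {ℓ : ℕ} (hK : IsComplex K) {G : Finset (Fin n)} (hG : G ∉ K) :
    ∏ i ∈ G, (X i : MvPolynomial (Fin n) k) ^ ℓ ∈ monIdeal k (symbU K ℓ) := by
  rw [mem_monIdeal_symbU]
  intro F hF
  obtain ⟨i, hiG, hiF⟩ : ∃ i ∈ G, i ∉ F := by
    by_contra! h
    exact hG (hK.2 F hF.1 G h)
  rw [← facePrime_pow]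
  exact Ideal.mem_of_dvd _ (Finset.dvd_prod_of_mem _ hiG)
    (Ideal.pow_mem_pow (X_mem_facePrime.mpr hiF) ℓ)

/-- The first two elementary symmetric polynomials are a system of parameters in dimension two. -/
theorem exists_socle_of_symm {N : Type} [AddCommGroup N] [Module (MvPolynomial (Fin n) k) N]
    {ℓ : ℕ} (hK : IsComplex K) (hcard : ∀ F, IsFacet K F → F.card ≤ 2) (z : N) (hz : z ≠ 0)
    (h0 : ∀ r ∈ monIdeal k (symbU K ℓ), r • z = 0)
    (h1 : (∑ i, (X i : MvPolynomial (Fin n) k)) • z = 0)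
    (h2 : (∑ s ∈ Finset.powersetCard 2 Finset.univ, ∏ i ∈ s, (X i : MvPolynomial (Fin n) k)) • z
      = 0) :
    ∃ z' : N, z' ≠ 0 ∧ ∀ i, (X i : MvPolynomial (Fin n) k) • z' = 0 := by
  classical
  refine exists_socle z hz fun Q hQ hann => ?_
  obtain ⟨F, hF, hFQ⟩ := exists_facePrime_le (K := K) hQ ℓ
    fun G hG => hann _ (h0 _ (prod_X_pow_mem_symbQuot k hK hG))
  have hX : ∀ i ∉ F, (X i : MvPolynomial (Fin n) k) ∈ Q := fun i hi =>
    hFQ (X_mem_facePrime.mpr hi)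
  have key : ∀ u, (∀ i, i ≠ u → (X i : MvPolynomial (Fin n) k) ∈ Q) →
      ∀ i, (X i : MvPolynomial (Fin n) k) ∈ Q := by
    intro u hu i
    by_cases hi : i = u
    · subst hi
      have hs := hann _ h1
      rw [← Finset.add_sum_erase _ _ (Finset.mem_univ i)] at hs
      exact (Submodule.add_mem_iff_left Q
        (Ideal.sum_mem _ fun j hj => hu j (Finset.ne_of_mem_erase hj))).mp hs
    · exact hu i hi
  by_cases h2F : F.card = 2
  · have hs := hann _ h2
    rw [← Finset.add_sum_erase _ _
      (Finset.mem_powersetCard.mpr ⟨Finset.subset_univ F, h2F⟩)] at hs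
    have hp := (Submodule.add_mem_iff_left Q (Ideal.sum_mem _ fun s hs => ?_)).mp hs
    · obtain ⟨u, hu, huQ⟩ := (hQ.prod_mem_iff).mp hp
      obtain ⟨v, hv⟩ := Finset.card_eq_one.mp
        (show (F.erase u).card = 1 by rw [Finset.card_erase_of_mem hu, h2F])
      refine key v fun i hi => ?_
      by_cases hiu : i = u
      · exact hiu ▸ huQ
      · refine hX i fun hiF => hi ?_
        rw [← Finset.mem_singleton, ← hv]
        exact Finset.mem_erase.mpr ⟨hiu, hiF⟩
    · rw [Finset.mem_erase, Finset.mem_powersetCard] at hs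
      obtain ⟨i, his, hiF⟩ : ∃ i ∈ s, i ∉ F := by
        by_contra! h
        exact hs.1 (Finset.eq_of_subset_of_card_le h (by omega))
      exact Ideal.mem_of_dvd _ (Finset.dvd_prod_of_mem _ his) (hX i hiF)
  · rcases F.eq_empty_or_nonempty with rfl | ⟨u, hu⟩
    · exact fun i => hX i (Finset.notMem_empty i)
    · refine key u fun i hi => hX i fun hiF => hi ?_
      have := hcard F hF
      exact Finset.card_le_one.mp (by omega) i hiF u hu

theorem monIdeal_symbU_le_maxIdeal {ℓ : ℕ} (hℓ : 1 ≤ ℓ) {F : Finset (Fin n)} (hF : IsFacet K F) :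
    monIdeal k (symbU K ℓ) ≤ maxIdeal k (Fin n) := by
  rw [maxIdeal_eq_facePrime]
  intro f hf
  refine mem_monIdeal.mpr fun a ha => mem_monIdeal.mp hf a fun h => ha ?_
  have h1 := h F hF
  have h2 : outDeg F a ≤ outDeg ∅ a :=
    Finset.sum_le_sum_of_subset (Finset.compl_subset_compl.mpr (Finset.empty_subset F))
  rw [mem_powU]
  omega

theorem sum_X_mem_maxIdeal : ∑ i, (X i : MvPolynomial (Fin n) k) ∈ maxIdeal k (Fin n) :=
  Ideal.sum_mem _ fun i _ => X_mem_maxIdeal i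

theorem not_extZero_residue_one_and_two {ℓ : ℕ} (hℓ : 1 ≤ ℓ) (hK : IsComplex K)
    (hne : ∀ F, IsFacet K F → F.Nonempty) (hcard : ∀ F, IsFacet K F → F.card ≤ 2) :
    ¬ (ExtZero (MvPolynomial (Fin n) k) (ResField k n) (SymbQuot k K ℓ) 1 ∧
      ExtZero (MvPolynomial (Fin n) k) (ResField k n) (SymbQuot k K ℓ) 2) := by
  rintro ⟨hE1, hE2⟩
  let e₂ : MvPolynomial (Fin n) k := ∑ s ∈ Finset.powersetCard 2 Finset.univ, ∏ i ∈ s, X i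
  have he₂ : e₂ ∈ maxIdeal k (Fin n) := Ideal.sum_mem _ fun s hs => by
    obtain ⟨i, hi⟩ : s.Nonempty := Finset.card_pos.mp (by
      rw [(Finset.mem_powersetCard.mp hs).2]
      simp)
    exact Ideal.mem_of_dvd _ (Finset.dvd_prod_of_mem _ hi) (X_mem_maxIdeal i)
  let φ := (∑ i, (X i : MvPolynomial (Fin n) k)) •
      (LinearMap.id : SymbQuot k K ℓ →ₗ[MvPolynomial (Fin n) k] SymbQuot k K ℓ)
  have hφ := isShortExact_mkQ_range φ (sum_X_smul_injective k ℓ hne)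
  have hN0 := hφ.ext_right (extZero_residue_symbQuot_zero k ℓ hne) hE1
  have hN1 := hφ.ext_right hE1 hE2
  have hJ : ∀ r ∈ monIdeal k (symbU K ℓ), ∀ z : SymbQuot k K ℓ ⧸ LinearMap.range φ, r • z = 0 := by
    intro r hr z
    obtain ⟨z, rfl⟩ := Submodule.mkQ_surjective _ z
    obtain ⟨f, rfl⟩ := Submodule.mkQ_surjective _ z
    rw [← map_smul, ← map_smul, Submodule.mkQ_apply (monIdeal k (symbU K ℓ)),
      (Submodule.Quotient.mk_eq_zero _).mpr (show r • f ∈ _ from Ideal.mul_mem_right f _ hr),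
      map_zero]
  have h1 : ∀ z : SymbQuot k K ℓ ⧸ LinearMap.range φ,
      (∑ i, (X i : MvPolynomial (Fin n) k)) • z = 0 := by
    intro z
    obtain ⟨z, rfl⟩ := Submodule.mkQ_surjective _ z
    rw [← map_smul, Submodule.mkQ_apply, Submodule.Quotient.mk_eq_zero]
    exact ⟨z, rfl⟩
  let ψ := e₂ • (LinearMap.id : (SymbQuot k K ℓ ⧸ LinearMap.range φ) →ₗ[MvPolynomial (Fin n) k] _)
  have hψ_inj : Function.Injective ψ := by
    rw [injective_iff_map_eq_zero]
    intro z hz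
    by_contra hz0
    obtain ⟨z', hz', hX⟩ := exists_socle_of_symm k hK hcard z hz0 (fun r hr => hJ r hr z) (h1 z) hz
    exact hz' (extZero_residue_zero_iff.mp hN0 z' hX)
  have hψ := isShortExact_mkQ_range ψ hψ_inj
  have hC0 := hψ.ext_right hN0 hN1
  let p : MvPolynomial (Fin n) k →ₗ[MvPolynomial (Fin n) k] _ :=
    (LinearMap.range ψ).mkQ ∘ₗ (LinearMap.range φ).mkQ ∘ₗ (monIdeal k (symbU K ℓ)).mkQ
  obtain ⟨F, hF, -⟩ := exists_facet K hK.1.some_mem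
  have hp : p 1 ≠ 0 := by
    intro h
    obtain ⟨z, hz⟩ := (Submodule.Quotient.mk_eq_zero _).mp h
    obtain ⟨z, rfl⟩ := Submodule.mkQ_surjective _ z
    obtain ⟨f, rfl⟩ := Submodule.mkQ_surjective _ z
    have hz' : (LinearMap.range φ).mkQ ((monIdeal k (symbU K ℓ)).mkQ (e₂ * f - 1)) = 0 := by
      rw [map_sub, map_sub, ← smul_eq_mul, map_smul, map_smul, sub_eq_zero]
      exact hz
    obtain ⟨w, hw⟩ := (Submodule.Quotient.mk_eq_zero _).mp hz'
    obtain ⟨g, rfl⟩ := Submodule.mkQ_surjective _ w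
    have hw' : (monIdeal k (symbU K ℓ)).mkQ ((∑ i, X i) * g - (e₂ * f - 1)) = 0 := by
      rw [map_sub, ← smul_eq_mul, map_smul, sub_eq_zero]
      exact hw
    have hmem := monIdeal_symbU_le_maxIdeal k hℓ hF ((Submodule.Quotient.mk_eq_zero _).mp hw')
    have h_one : (1 : MvPolynomial (Fin n) k) ∈ maxIdeal k (Fin n) := by
      have h3 := sub_mem hmem (Ideal.mul_mem_right g _ (sum_X_mem_maxIdeal k))
      have h4 := add_mem h3 (Ideal.mul_mem_right f _ he₂)
      ring_nf at h4
      exact h4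
    rw [maxIdeal_eq_facePrime] at h_one
    exact (facePrime_isPrime ∅).ne_top ((Ideal.eq_top_iff_one _).mpr h_one)
  obtain ⟨z', hz', hX⟩ := exists_socle_of_symm k (ℓ := ℓ) hK hcard (p 1) hp (fun r hr => by
      change r • (LinearMap.range ψ).mkQ _ = 0
      rw [← map_smul]
      erw [hJ r hr]
      exact map_zero _) (by
      change (∑ i, X i : MvPolynomial (Fin n) k) • (LinearMap.range ψ).mkQ _ = 0
      rw [← map_smul, h1]
      exact map_zero _) (by
      change e₂ • (LinearMap.range ψ).mkQ _ = 0
      rw [← map_smul]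
      exact (Submodule.Quotient.mk_eq_zero _).mpr ⟨_, rfl⟩)
  exact hz' (extZero_residue_zero_iff.mp hC0 z' hX)

end SymbolicQuotient

open Abelian

/-! ### Annihilators of the `Ext` modules into the polynomial ring -/

section Annihilators

variable {k : Type} [Field k] {n : ℕ} {K : Set (Finset (Fin n))} {ℓ : ℕ}

theorem not_extZero_residue_top :
    ¬ ExtZero (MvPolynomial (Fin n) k) (ResField k n) (MvPolynomial (Fin n) k) n := by
  intro h
  unfold ResField at h
  rw [maxIdeal_eq_facePrime] at h
  have := mem_facePrime_of_extKill (k := k) (F := (∅ : Finset (Fin n))) (r := 1) fun e => by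
    rw [one_smul]
    exact h e
  exact (facePrime_isPrime ∅).ne_top ((Ideal.eq_top_iff_one _).mpr this)

theorem extKill_facePrime_of_powU {F : Finset (Fin n)} (hℓ : 1 ≤ ℓ) {r : MvPolynomial (Fin n) k}
    (h : ExtKill (MvPolynomial (Fin n) k) r (MvPolynomial (Fin n) k ⧸ monIdeal k (powU F ℓ))
      (MvPolynomial (Fin n) k) (n - F.card)) :
    ExtKill (MvPolynomial (Fin n) k) r (MvPolynomial (Fin n) k ⧸ facePrime k F)
      (MvPolynomial (Fin n) k) (n - F.card) := by
  by_cases hF : ∃ w, w ∉ F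
  · obtain ⟨w, hw⟩ := hF
    obtain ⟨_, _, hs⟩ := exists_isShortExact_colon (k := k) (U := powU F ℓ) (V := powU F 1)
      (W := addU (powU F ℓ) (Finsupp.single w (ℓ - 1))) (Finsupp.single w (ℓ - 1))
      (fun a => by
        rw [mem_powU, mem_powU, outDeg_add, outDeg_single, if_neg hw]
        omega) (fun a => Iff.rfl)
    refine hs.extKill_left_of_extZero h ?_
    have hpd := pdLT_monIdeal (k := k) ℓ Fᶜ (addU (powU F ℓ) (Finsupp.single w (ℓ - 1)))
      fun a b hab => Or.imp (powU_congr fun i hi => hab i (Finset.mem_compl.mpr hi)) fun h => by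
        have := hab w (Finset.mem_compl.mpr hw)
        rw [Finsupp.single_le_iff] at h ⊢
        omega
    rw [Finset.card_compl, Fintype.card_fin] at hpd
    exact hpd.extZero le_rfl
  · push Not at hF
    have hU : powU F 1 = powU F ℓ := by
      ext a
      have h0 : outDeg F a = 0 := by
        rw [outDeg, Finset.eq_univ_of_forall hF, Finset.compl_univ, Finset.sum_empty]
      rw [SetLike.mem_coe, SetLike.mem_coe, mem_powU, mem_powU, h0]
      omega
    rw [facePrime, hU]
    exact h

theorem mem_facePrime_of_extKill_symbQuot (hℓ : 1 ≤ ℓ) {F : Finset (Fin n)} (hF : IsFacet K F)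
    {r : MvPolynomial (Fin n) k}
    (h : ExtKill (MvPolynomial (Fin n) k) r (SymbQuot k K ℓ) (MvPolynomial (Fin n) k)
      (n - F.card)) : r ∈ facePrime k F := by
  let b : Fin n →₀ ℕ := Finsupp.equivFunOnFinite.symm fun i => if i ∈ F then ℓ else 0
  have hb : ∀ i, b i = if i ∈ F then ℓ else 0 := fun i => rfl
  have hbF : outDeg F b = 0 := Finset.sum_eq_zero fun i hi => by
    rw [hb, if_neg (Finset.mem_compl.mp hi)]
  obtain ⟨_, _, hs⟩ := exists_isShortExact_colon (k := k) (U := symbU K ℓ) (V := powU F ℓ)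
    (W := addU (symbU K ℓ) b) b
    (fun a => by
      rw [mem_symbU, mem_powU]
      constructor
      · intro ha G hG
        rw [outDeg_add]
        by_cases hFG : F ⊆ G
        · rw [hF.2 G hG.1 hFG]
          omega
        · obtain ⟨i, hi, hiG⟩ := Finset.not_subset.mp hFG
          have h1 : b i ≤ outDeg G b :=
            Finset.single_le_sum (f := fun j => b j) (fun _ _ => Nat.zero_le _)
              (Finset.mem_compl.mpr hiG)
          rw [hb, if_pos hi] at h1
          omega
      · intro ha
        have := ha F hF
        rwa [outDeg_add, hbF, zero_add] at this) (fun a => Iff.rfl)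
  have h1 := hs.extKill_left (s := monomial b 1) h fun c => by
    obtain ⟨f, rfl⟩ := Submodule.mkQ_surjective _ c
    rw [Submodule.mkQ_apply, ← Submodule.Quotient.mk_smul, Submodule.Quotient.mk_eq_zero]
    refine Ideal.mul_mem_right _ _ (monomial_mem_monIdeal.mpr (Or.inr le_rfl))
  have h2 := mem_facePrime_of_extKill (extKill_facePrime_of_powU hℓ h1)
  refine ((facePrime_isPrime F).mem_or_mem h2).resolve_right fun h3 => ?_
  have := monomial_mem_monIdeal.mp h3
  rw [mem_powU, hbF] at this
  omega

end Annihilators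

open Abelian

/-! ### Connectedness of the degree complexes -/

section DegreeComplexes

variable {n : ℕ}

/-- `F` is a facet of the degree complex of the `ℓ`-th symbolic power at `a`. -/
def IsNear (K : Set (Finset (Fin n))) (ℓ : ℕ) (a : Fin n →₀ ℕ) (F : Finset (Fin n)) : Prop :=
  IsFacet K F ∧ outDeg F a < ℓ

/-- Some degree complex of the `ℓ`-th symbolic power is disconnected. -/
def HasSplitting (K : Set (Finset (Fin n))) (ℓ : ℕ) : Prop :=
  ∃ (a : Fin n →₀ ℕ) (E : Set (Finset (Fin n))), (∃ F ∈ E, IsNear K ℓ a F) ∧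
    (∃ G ∉ E, IsNear K ℓ a G) ∧
    ∀ F ∈ E, ∀ G ∉ E, IsNear K ℓ a F → IsNear K ℓ a G → Disjoint F G

variable (k : Type) [Field k] (K : Set (Finset (Fin n))) (ℓ : ℕ)

/-- Ordered pairs of intersecting facets. -/
abbrev MeetingPair : Type :=
  {p : {F : Finset (Fin n) // IsFacet K F} × {F : Finset (Fin n) // IsFacet K F} //
    ¬ Disjoint p.1.1 p.2.1}

/-- The product of the local pieces over the pairs of intersecting facets. -/
abbrev PairProd : Type :=
  ∀ p : MeetingPair K, MvPolynomial (Fin n) k ⧸ monIdeal k (sumU p.1.1.1 p.1.2.1 ℓ)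

theorem monIdeal_powU_le_left (F G : Finset (Fin n)) :
    monIdeal k (powU F ℓ) ≤ monIdeal k (sumU F G ℓ) := fun _ hf =>
  mem_monIdeal.mpr fun a ha => mem_monIdeal.mp hf a fun h => ha (Or.inl h)

theorem monIdeal_powU_le_right (F G : Finset (Fin n)) :
    monIdeal k (powU G ℓ) ≤ monIdeal k (sumU F G ℓ) := fun _ hf =>
  mem_monIdeal.mpr fun a ha => mem_monIdeal.mp hf a fun h => ha (Or.inr h)

/-- The difference map from the product over facets to the product over pairs. -/
noncomputable def pairDiff :
    FacetProd k K ℓ →ₗ[MvPolynomial (Fin n) k] PairProd k K ℓ :=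
  LinearMap.pi fun p =>
    Submodule.factor (monIdeal_powU_le_left k ℓ p.1.1.1 p.1.2.1) ∘ₗ LinearMap.proj p.1.1 -
      Submodule.factor (monIdeal_powU_le_right k ℓ p.1.1.1 p.1.2.1) ∘ₗ LinearMap.proj p.1.2

variable {K ℓ}

theorem range_toFacetProd_eq_ker (h : ¬ HasSplitting K ℓ) :
    LinearMap.range (toFacetProd k K ℓ) = LinearMap.ker (pairDiff k K ℓ) := by
  classical
  have := Fintype.ofFinite {F : Finset (Fin n) // IsFacet K F}
  apply le_antisymm
  · rintro _ ⟨z, rfl⟩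
    obtain ⟨f, rfl⟩ := Submodule.mkQ_surjective _ z
    rw [LinearMap.mem_ker]
    ext1 p
    exact sub_self (Submodule.Quotient.mk f : MvPolynomial (Fin n) k ⧸ monIdeal k _)
  · intro z hz
    choose f hf using fun F => Submodule.mkQ_surjective _ (z F)
    have hpair : ∀ F G : {F : Finset (Fin n) // IsFacet K F}, ¬ Disjoint F.1 G.1 → ∀ a,
        IsNear K ℓ a F → IsNear K ℓ a G → (f F).coeff a = (f G).coeff a := by
      intro F G hFG a hF hG
      have h1 := congrFun hz ⟨(F, G), hFG⟩
      change Submodule.factor (monIdeal_powU_le_left k ℓ F.1 G.1) (z F) -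
        Submodule.factor (monIdeal_powU_le_right k ℓ F.1 G.1) (z G) = 0 at h1
      rw [← hf, ← hf] at h1
      have h2 : f F - f G ∈ monIdeal k (sumU F.1 G.1 ℓ) := (Submodule.Quotient.mk_eq_zero _).mp h1
      have h3 := mem_monIdeal.mp h2 a fun h => by
        rw [mem_sumU, mem_powU, mem_powU] at h
        have := hF.2
        have := hG.2
        omega
      rwa [coeff_sub, sub_eq_zero] at h3
    have hall : ∀ F G : {F : Finset (Fin n) // IsFacet K F}, ∀ a,
        IsNear K ℓ a F → IsNear K ℓ a G → (f F).coeff a = (f G).coeff a := by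
      intro F G a hF hG
      by_contra hne
      refine h ⟨a, {H | ∃ hH : IsFacet K H, (f F).coeff a = (f ⟨H, hH⟩).coeff a},
        ⟨F, ⟨F.2, rfl⟩, hF⟩, ⟨G, fun ⟨_, h⟩ => hne h, hG⟩, ?_⟩
      rintro H ⟨hH, hFH⟩ H' hH' hnH hnH'
      by_contra hd
      exact hH' ⟨hnH'.1, hFH.trans (hpair ⟨H, hH⟩ ⟨H', hnH'.1⟩ hd a hnH hnH')⟩
    let c : (Fin n →₀ ℕ) → k := fun a =>
      if h : ∃ F : {F : Finset (Fin n) // IsFacet K F}, IsNear K ℓ a F then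
        (f h.choose).coeff a else 0
    have hc : ∀ (F : {F : Finset (Fin n) // IsFacet K F}) a, IsNear K ℓ a F →
        c a = (f F).coeff a := by
      intro F a hF
      have hex : ∃ F : {F : Finset (Fin n) // IsFacet K F}, IsNear K ℓ a F := ⟨F, hF⟩
      simp only [c, dif_pos hex]
      exact hall _ _ a hex.choose_spec hF
    let T : Finset (Fin n →₀ ℕ) := Finset.univ.biUnion fun F => (f F).support
    let g : MvPolynomial (Fin n) k := ∑ a ∈ T, monomial a (c a)
    have hg : ∀ (F : {F : Finset (Fin n) // IsFacet K F}) a, IsNear K ℓ a F →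
        g.coeff a = (f F).coeff a := by
      intro F a hF
      simp only [g, coeff_sum, coeff_monomial, Finset.sum_ite_eq']
      split_ifs with ha
      · exact hc F a hF
      · by_contra hne
        exact ha (Finset.mem_biUnion.mpr ⟨F, Finset.mem_univ F, mem_support_iff.mpr (Ne.symm hne)⟩)
    refine ⟨Submodule.Quotient.mk g, ?_⟩
    ext1 F
    rw [toFacetProd_mk, ← hf F, Submodule.mkQ_apply, Submodule.Quotient.eq, mem_monIdeal]
    intro a ha
    rw [coeff_sub, hg F a ⟨F.2, by rw [mem_powU] at ha; omega⟩, sub_self]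

theorem exists_injective_facetCoker (h : ¬ HasSplitting K ℓ) :
    ∃ φ : FacetCoker k K ℓ →ₗ[MvPolynomial (Fin n) k] PairProd k K ℓ, Function.Injective φ :=
  ⟨Submodule.liftQ _ (pairDiff k K ℓ) (range_toFacetProd_eq_ker k h).le,
    LinearMap.ker_eq_bot.mp (Submodule.ker_liftQ_eq_bot' _ _ (range_toFacetProd_eq_ker k h))⟩

theorem extZero_residue_symbQuot_one (h : ¬ HasSplitting K ℓ)
    (hcard : ∀ F, IsFacet K F → F.card = 2) :
    ExtZero (MvPolynomial (Fin n) k) (ResField k n) (SymbQuot k K ℓ) 1 := by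
  refine (isShortExact_toFacetProd k K ℓ).ext_left ?_ (extZero_pi_right fun F => ?_)
  · obtain ⟨φ, hφ⟩ := exists_injective_facetCoker k h
    refine ExtZero.of_injective (extZero_pi_right fun p => ?_) φ hφ
    obtain ⟨u, hu, hu'⟩ := Finset.not_disjoint_iff.mp p.2
    exact extZero_residue_monIdeal_zero fun a => Or.imp (powU_cancel hu a) (powU_cancel hu' a)
  · obtain ⟨u, v, huv, hF⟩ := Finset.card_eq_two.mp (hcard F.1 F.2)
    exact extZero_residue_monIdeal_one huv (powU_cancel (by simp [hF]))
      (powU_cancel (by simp [hF]))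

theorem extZero_symbQuot_pred_top (h : ¬ HasSplitting K ℓ)
    (hcard : ∀ F, IsFacet K F → F.card = 2) (hn : 2 ≤ n) :
    ExtZero (MvPolynomial (Fin n) k) (SymbQuot k K ℓ) (MvPolynomial (Fin n) k) (n - 1) := by
  refine (isShortExact_toFacetProd k K ℓ).ext'_left (extZero_pi_left fun F =>
    (pdLT_powU F.1 ℓ).extZero (by rw [hcard F.1 F.2]; omega)) ?_
  rw [Nat.sub_add_cancel (by omega)]
  obtain ⟨φ, hφ⟩ := exists_injective_facetCoker k h
  refine (isShortExact_mkQ_range φ hφ).ext'_left (extZero_pi_left fun p =>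
    (pdLT_sumU p.1.1.1 p.1.2.1 ℓ).extZero ?_) ((globalDimLT_mvPolynomial k n _).extZero le_rfl)
  have h1 := (Finset.not_disjoint_iff_nonempty_inter.mp p.2).card_pos
  omega

theorem exists_socle_facetCoker (h : HasSplitting K ℓ) :
    ∃ z : FacetCoker k K ℓ, z ≠ 0 ∧ ∀ i, (X i : MvPolynomial (Fin n) k) • z = 0 := by
  classical
  obtain ⟨a, E, ⟨F, hFE, hF⟩, ⟨G, hGE, hG⟩, hd⟩ := h
  let z : FacetProd k K ℓ := fun H =>
    if H.1 ∈ E then Submodule.Quotient.mk (monomial a 1) else 0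
  refine exists_socle ((LinearMap.range (toFacetProd k K ℓ)).mkQ z) (fun h0 => ?_)
    fun Q hQ hann u => hQ.mem_of_pow_mem ℓ (hann _ ?_)
  · obtain ⟨w, hw⟩ := (Submodule.Quotient.mk_eq_zero _).mp h0
    obtain ⟨f, rfl⟩ := Submodule.mkQ_surjective _ w
    have h1 := congrFun hw ⟨F, hF.1⟩
    have h2 := congrFun hw ⟨G, hG.1⟩
    rw [Submodule.mkQ_apply, toFacetProd_mk] at h1 h2
    simp only [z, if_pos hFE, if_neg hGE] at h1 h2
    rw [Submodule.Quotient.eq, mem_monIdeal] at h1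
    rw [Submodule.Quotient.mk_eq_zero, mem_monIdeal] at h2
    have h1 := h1 a fun h => (Nat.not_le.mpr hF.2) h
    have h2 := h2 a fun h => (Nat.not_le.mpr hG.2) h
    rw [coeff_sub, h2, coeff_monomial, if_pos rfl, zero_sub, neg_eq_zero] at h1
    exact one_ne_zero h1
  · rw [← map_smul]
    refine (Submodule.Quotient.mk_eq_zero _).mpr ?_
    have hzero : ∀ H, IsFacet K H → (IsNear K ℓ a H → u ∉ H) →
        (X u : MvPolynomial (Fin n) k) ^ ℓ * monomial a 1 ∈ monIdeal k (powU H ℓ) := by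
      intro H hH hu
      rw [X_pow_eq_monomial, monomial_mul, one_mul, monomial_mem_monIdeal, mem_powU, outDeg_add,
        outDeg_single]
      by_cases hn : outDeg H a < ℓ
      · rw [if_neg (hu ⟨hH, hn⟩)]
        omega
      · omega
    by_cases hex : ∃ H ∈ E, IsNear K ℓ a H ∧ u ∈ H
    · obtain ⟨H, hHE, hH, hu⟩ := hex
      refine ⟨Submodule.Quotient.mk (X u ^ ℓ * monomial a 1), ?_⟩
      ext1 H'
      rw [toFacetProd_mk, Pi.smul_apply]
      simp only [z]
      split_ifs with hH'
      · rfl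
      · rw [smul_zero, Submodule.Quotient.mk_eq_zero]
        exact hzero H' H'.2 fun hn =>
          Finset.disjoint_left.mp (hd H hHE H' hH' hH hn) hu
    · refine ⟨0, ?_⟩
      rw [map_zero]
      ext1 H'
      rw [Pi.smul_apply]
      simp only [z]
      split_ifs with hH'
      · exact ((Submodule.Quotient.mk_eq_zero _).mpr
          (hzero H' H'.2 fun hn hu => hex ⟨H', hH', hn, hu⟩)).symm
      · exact (smul_zero _).symm

theorem not_extZero_residue_symbQuot_one (h : HasSplitting K ℓ)
    (hne : ∀ F, IsFacet K F → F.Nonempty) :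
    ¬ ExtZero (MvPolynomial (Fin n) k) (ResField k n) (SymbQuot k K ℓ) 1 := by
  intro h1
  obtain ⟨z, hz, hX⟩ := exists_socle_facetCoker k h
  exact hz (extZero_residue_zero_iff.mp ((isShortExact_toFacetProd k K ℓ).ext_right
    (extZero_residue_facetProd_zero k ℓ hne) h1) z hX)

theorem not_extZero_symbQuot_pred_top (h : HasSplitting K ℓ)
    (hne : ∀ F, IsFacet K F → F.Nonempty) (hn : 1 ≤ n) :
    ¬ ExtZero (MvPolynomial (Fin n) k) (SymbQuot k K ℓ) (MvPolynomial (Fin n) k) (n - 1) := by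
  intro h1
  obtain ⟨z, hz, hX⟩ := exists_socle_facetCoker k h
  obtain ⟨φ, -, hφ⟩ := exists_residue_map z hX
  have hn' : n - 1 + 1 = n := Nat.sub_add_cancel hn
  have h2 := (isShortExact_toFacetProd k K ℓ).ext'_right (i := n - 1) h1 (by
    rw [hn']
    exact extZero_facetProd_top k ℓ hne)
  rw [hn'] at h2
  exact not_extZero_residue_top ((isShortExact_mkQ_range φ (hφ hz)).ext'_left h2
    ((globalDimLT_mvPolynomial k n _).extZero le_rfl))

end DegreeComplexes

open Abelian

/-! ### Propagation of disconnected degree complexes -/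

section Propagation

variable {n : ℕ} {K : Set (Finset (Fin n))} {ℓ : ℕ}

theorem isFacet_of_card_eq_two (hdim : HasDimCard K 2) {F : Finset (Fin n)} (hF : F ∈ K)
    (h : F.card = 2) : IsFacet K F :=
  ⟨hF, fun G hG hFG => (Finset.eq_of_subset_of_card_le hFG (h ▸ hdim.2 G hG)).symm⟩

theorem IsFacet.nonempty_of_dim (hdim : HasDimCard K 2) {F : Finset (Fin n)} (hF : IsFacet K F) :
    F.Nonempty := by
  rw [Finset.nonempty_iff_ne_empty]
  rintro rfl
  obtain ⟨G, hG, h⟩ := hdim.1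
  rw [hF.2 G hG (Finset.empty_subset G)] at h
  simp at h

theorem hasSplitting_of_isolated (hℓ : 1 ≤ ℓ) {F G : Finset (Fin n)} (hF : IsFacet K F)
    (hF1 : F.card = 1) (hG : IsFacet K G) (hFG : G ≠ F) : HasSplitting K ℓ := by
  have h0 : ∀ H, outDeg H (0 : Fin n →₀ ℕ) < ℓ := fun H => by
    have h : outDeg H (0 : Fin n →₀ ℕ) = 0 := Finset.sum_eq_zero fun _ _ => rfl
    omega
  refine ⟨0, {F}, ⟨F, rfl, hF, h0 F⟩, ⟨G, hFG, hG, h0 G⟩, ?_⟩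
  rintro _ rfl H hH - hnH
  obtain ⟨w, rfl⟩ := Finset.card_eq_one.mp hF1
  rw [Finset.disjoint_singleton_left]
  exact fun hw => hH (hF.2 H hnH.1.1 (Finset.singleton_subset_iff.mpr hw))

theorem hasSplitting_of_no_edges (hK : IsComplex K) (hℓ : 3 ≤ ℓ) {F G : Finset (Fin n)}
    (hF : IsFacet K F) (hG : IsFacet K G) (hG2 : G.card = 2) {u : Fin n} (hu : u ∈ F)
    (huG : ∀ x ∈ G, ({u, x} : Finset (Fin n)) ∉ K) : HasSplitting K ℓ := by
  have hu' : u ∉ G := fun h => huG u h (hK.2 F hF.1 _ (by simpa using hu))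
  let a : Fin n →₀ ℕ := Finsupp.equivFunOnFinite.symm fun i =>
    (if u = i then ℓ - 1 else 0) + if i ∈ G then 1 else 0
  have ha : ∀ H, outDeg H a = (if u ∈ H then 0 else ℓ - 1) + (G \ H).card := by
    intro H
    have h1 : ∀ i, a i = (if u = i then ℓ - 1 else 0) + if i ∈ G then 1 else 0 := fun i => rfl
    simp only [outDeg, h1, Finset.sum_add_distrib, Finset.sum_ite_eq, Finset.mem_compl, ite_not,
      Finset.sum_boole, Nat.cast_id]
    congr 2
    ext i
    simp [and_comm]
  have hnear : ∀ H, IsNear K ℓ a H → u ∈ H ∨ H = G := by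
    intro H hH
    by_cases huH : u ∈ H
    · exact Or.inl huH
    · refine Or.inr (hG.2 H hH.1.1 (Finset.sdiff_eq_empty_iff_subset.mp ?_))
      have := hH.2
      rw [ha, if_neg huH] at this
      exact Finset.card_eq_zero.mp (by omega)
  refine ⟨a, {G}, ⟨G, rfl, hG, ?_⟩, ⟨F, fun h => hu' (h ▸ hu), hF, ?_⟩, ?_⟩
  · rw [ha, if_neg hu', Finset.sdiff_self, Finset.card_empty]
    omega
  · have := Finset.card_le_card (Finset.sdiff_subset (s := G) (t := F))
    rw [ha, if_pos hu]
    omega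
  · rintro _ rfl H hH - hnH
    have huH := (hnear H hnH).resolve_right hH
    refine Finset.disjoint_left.mpr fun x hx hxH => huG x hx (hK.2 H hnH.1.1 _ ?_)
    simp [Finset.insert_subset_iff, huH, hxH]

theorem HasSplitting.succ (hK : IsComplex K) (hdim : HasDimCard K 2)
    (hcard : ∀ F, IsFacet K F → F.card = 2) (h : HasSplitting K ℓ) :
    HasSplitting K (ℓ + 1) := by
  obtain ⟨a, E, ⟨F, hFE, hF⟩, ⟨G, hGE, hG⟩, hd⟩ := h
  have hFG := hd F hFE G hGE hF hG
  have hmeet : ∀ H, IsNear K ℓ a H → ∀ u ∈ F, u ∈ H → ∀ x ∈ G, x ∉ H := by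
    intro H hH u huF huH x hxG hxH
    by_cases hHE : H ∈ E
    · exact Finset.disjoint_left.mp (hd H hHE G hGE hH hG) hxH hxG
    · exact Finset.disjoint_left.mp (hd F hFE H hHE hF hH) huF huH
  rcases Nat.lt_or_ge ℓ 2 with hℓ | hℓ
  · have ha : ∀ i, a i = 0 := by
      intro i
      have key : ∀ H, outDeg H a < ℓ → i ∉ H → a i = 0 := fun H hH hi =>
        Finset.sum_eq_zero_iff.mp (show outDeg H a = 0 by omega) i (Finset.mem_compl.mpr hi)
      by_cases hi : i ∈ F
      · exact key G hG.2 (Finset.disjoint_left.mp hFG hi)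
      · exact key F hF.2 hi
    have h0 : ∀ H, outDeg H a = 0 := fun H => Finset.sum_eq_zero fun i _ => ha i
    have hlt : ∀ H, outDeg H a < ℓ := fun H => by
      have := hF.2
      have := h0 H
      omega
    exact ⟨a, E, ⟨F, hFE, hF.1, (hlt F).trans (Nat.lt_succ_self ℓ)⟩,
      ⟨G, hGE, hG.1, (hlt G).trans (Nat.lt_succ_self ℓ)⟩,
      fun H hH H' hH' hn hn' => hd H hH H' hH' ⟨hn.1, hlt H⟩ ⟨hn'.1, hlt H'⟩⟩
  · obtain ⟨u, v, huv, rfl⟩ := Finset.card_eq_two.mp (hcard F hF.1)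
    obtain ⟨x, y, hxy, rfl⟩ := Finset.card_eq_two.mp (hcard G hG.1)
    have hne : ∀ i ∈ ({u, v} : Finset (Fin n)), ∀ j ∈ ({x, y} : Finset (Fin n)), i ≠ j :=
      fun i hi j hj hij => Finset.disjoint_left.mp hFG hi (hij ▸ hj)
    have hfacet : ∀ i ∈ ({u, v} : Finset (Fin n)), ∀ j ∈ ({x, y} : Finset (Fin n)),
        ({i, j} : Finset (Fin n)) ∈ K → ℓ ≤ outDeg {i, j} a := by
      intro i hi j hj hij
      by_contra hlt
      exact hmeet {i, j} ⟨isFacet_of_card_eq_two hdim hij (Finset.card_pair (hne i hi j hj)),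
        Nat.lt_of_not_le hlt⟩ i hi (by simp) j hj (by simp)
    have hsum : ∀ i j, i ≠ j → outDeg {i, j} a + (a i + a j) = ∑ t, a t := fun i j hij => by
      rw [← Finset.sum_pair hij]
      exact Finset.sum_compl_add_sum _ _
    have hcross₁ : ¬ (({u, x} : Finset (Fin n)) ∈ K ∧ ({v, y} : Finset (Fin n)) ∈ K) := by
      rintro ⟨h1, h2⟩
      have h3 := hfacet u (by simp) x (by simp) h1
      have h4 := hfacet v (by simp) y (by simp) h2
      have := hsum u v huv
      have := hsum x y hxy
      have := hsum u x (hne u (by simp) x (by simp))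
      have := hsum v y (hne v (by simp) y (by simp))
      have := hF.2
      have := hG.2
      omega
    have hcross₂ : ¬ (({u, y} : Finset (Fin n)) ∈ K ∧ ({v, x} : Finset (Fin n)) ∈ K) := by
      rintro ⟨h1, h2⟩
      have h3 := hfacet u (by simp) y (by simp) h1
      have h4 := hfacet v (by simp) x (by simp) h2
      have := hsum u v huv
      have := hsum x y hxy
      have := hsum u y (hne u (by simp) y (by simp))
      have := hsum v x (hne v (by simp) x (by simp))
      have := hF.2
      have := hG.2
      omega
    have hF' := hF.1
    have hG' := hG.1
    have hℓ' : 3 ≤ ℓ + 1 := by omega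
    by_cases h1 : ({u, x} : Finset (Fin n)) ∈ K
    · have h4 : ({v, y} : Finset (Fin n)) ∉ K := fun h => hcross₁ ⟨h1, h⟩
      by_cases h2 : ({u, y} : Finset (Fin n)) ∈ K
      · have h3 : ({v, x} : Finset (Fin n)) ∉ K := fun h => hcross₂ ⟨h2, h⟩
        exact hasSplitting_of_no_edges hK hℓ' hF' hG' (hcard _ hG') (u := v) (by simp)
          (by simp [h3, h4])
      · exact hasSplitting_of_no_edges hK hℓ' hG' hF' (hcard _ hF') (u := y) (by simp)
          (by simp [Finset.pair_comm y, h2, h4])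
    · by_cases h2 : ({u, y} : Finset (Fin n)) ∈ K
      · have h3 : ({v, x} : Finset (Fin n)) ∉ K := fun h => hcross₂ ⟨h2, h⟩
        exact hasSplitting_of_no_edges hK hℓ' hG' hF' (hcard _ hF') (u := x) (by simp)
          (by simp [Finset.pair_comm x, h1, h3])
      · exact hasSplitting_of_no_edges hK hℓ' hF' hG' (hcard _ hG') (u := u) (by simp)
          (by simp [h1, h2])

theorem exists_facet_card_eq_two (hdim : HasDimCard K 2) : ∃ F, IsFacet K F ∧ F.card = 2 := by
  obtain ⟨F, hF, h⟩ := hdim.1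
  exact ⟨F, isFacet_of_card_eq_two hdim hF h, h⟩

theorem hasSplitting_succ (hK : IsComplex K) (hdim : HasDimCard K 2)
    (h : ¬ HasSplitting K ℓ → ¬ ∀ F, IsFacet K F → F.card = 2) : HasSplitting K (ℓ + 1) := by
  by_cases hcard : ∀ F, IsFacet K F → F.card = 2
  · exact HasSplitting.succ hK hdim hcard (by_contra fun hs => h hs hcard)
  · push Not at hcard
    obtain ⟨F, hF, hF2⟩ := hcard
    obtain ⟨G, hG, hG2⟩ := exists_facet_card_eq_two hdim
    have h1 := (hF.nonempty_of_dim hdim).card_pos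
    have h2 := hdim.2 F hF.1
    exact hasSplitting_of_isolated (Nat.le_add_left 1 ℓ) hF (by omega) hG
      fun h => hF2 (h ▸ hG2)

end Propagation

/-! ### The sets computing the two depths -/

section Depths

variable {k : Type} [Field k] {n : ℕ} {K : Set (Finset (Fin n))} {ℓ : ℕ}

theorem nontrivial_extM_iff_not_extZero {R M N : Type} [CommRing R] [AddCommGroup M] [Module R M]
    [AddCommGroup N] [Module R N] {i : ℕ} :
    Nontrivial (extM (ModuleCat.of R M) (ModuleCat.of R N) i) ↔ ¬ ExtZero R M N i := by
  rw [nontrivial_extM_iff, ← not_subsingleton_iff_nontrivial, subsingleton_iff_forall_eq 0]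
  rfl

theorem zero_le_modDim_iff {R : Type} [CommRing R] (M : ModuleCat R) :
    0 ≤ modDim M ↔ Nontrivial M := by
  rw [modDim, ringKrullDim, Order.krullDim_nonneg_iff, PrimeSpectrum.nonempty_iff_nontrivial,
    Ideal.Quotient.nontrivial_iff, ne_eq, Module.annihilator_eq_top_iff,
    not_subsingleton_iff_nontrivial]

theorem one_le_modDim_of_annihilator_le {R : Type} [CommRing R] (M : ModuleCat R)
    {P Q : Ideal R} (hP : P.IsPrime) (hQ : Q.IsPrime) (hPQ : P < Q)
    (h : Module.annihilator R M ≤ P) : 1 ≤ modDim M := by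
  rw [modDim, ringKrullDim_quotient, Order.one_le_krullDim_iff]
  exact ⟨⟨⟨P, hP⟩, h⟩, ⟨⟨Q, hQ⟩, h.trans hPQ.le⟩, hPQ⟩

theorem mem_depth_set_iff (hK : IsComplex K) (i : ℕ) :
    Nontrivial (extM (quotMod k (maxIdeal k (Fin n))) (quotMod k (symbPow (srIdeal k K) ℓ)) i) ↔
      ¬ ExtZero (MvPolynomial (Fin n) k) (ResField k n) (SymbQuot k K ℓ) i := by
  rw [symbPow_srIdeal hK]
  exact nontrivial_extM_iff_not_extZero

theorem mem_serreDepth_set_iff (hK : IsComplex K) {j : ℕ} (hj : j ≤ 1) :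
    ((j + 1 - 2 : ℕ) : WithBot ℕ∞) ≤ modDim (serreK k (quotMod k (symbPow (srIdeal k K) ℓ)) j) ↔
      ¬ ExtZero (MvPolynomial (Fin n) k) (SymbQuot k K ℓ) (MvPolynomial (Fin n) k) (n - j) := by
  rw [symbPow_srIdeal hK, show j + 1 - 2 = 0 by omega, Nat.cast_zero, zero_le_modDim_iff, serreK,
    Nat.card_eq_fintype_card, Fintype.card_fin]
  exact nontrivial_extM_iff_not_extZero

theorem two_mem_serreDepth_set (hℓ : 1 ≤ ℓ) (hK : IsComplex K) (hdim : HasDimCard K 2) :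
    ((2 + 1 - 2 : ℕ) : WithBot ℕ∞) ≤
      modDim (serreK k (quotMod k (symbPow (srIdeal k K) ℓ)) 2) := by
  obtain ⟨F, hF, hF2⟩ := exists_facet_card_eq_two hdim
  have hlt : facePrime k F < facePrime k ∅ := by
    refine lt_of_le_not_ge (facePrime_le_iff.mpr (Finset.empty_subset F)) fun h => ?_
    rw [facePrime_le_iff, Finset.subset_empty] at h
    simp [h] at hF2
  rw [symbPow_srIdeal hK, show 2 + 1 - 2 = 1 from rfl, Nat.cast_one, serreK,
    Nat.card_eq_fintype_card, Fintype.card_fin]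
  refine one_le_modDim_of_annihilator_le _ (facePrime_isPrime F) (facePrime_isPrime ∅) hlt
    fun r hr => mem_facePrime_of_extKill_symbQuot hℓ hF ?_
  rw [hF2]
  exact (smul_extM_eq_zero_iff _ _ _ r).mp (Module.mem_annihilator.mp hr)

end Depths

/-- Theorem `non-increasing for dim1`: for a simplicial complex `Δ`
with `dim Δ = 1` and `ℓ ≥ 1`, `depth(S/I_Δ^(ℓ)) ≥ depth(S/I_Δ^(ℓ+1))`; moreover, if `Δ`
is pure, then `S_2-depth(S/I_Δ^(ℓ)) ≥ S_2-depth(S/I_Δ^(ℓ+1))`. -/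
theorem depth_symbPow_nonincreasing_of_dim_one
    (k : Type) [Field k] (n ℓ : ℕ) (hℓ : 1 ≤ ℓ)
    (K : Set (Finset (Fin n))) (hK : IsComplex K) (hdim : HasDimCard K 2) :
    mdepth k (quotMod k (symbPow (srIdeal k K) (ℓ + 1))) ≤
      mdepth k (quotMod k (symbPow (srIdeal k K) ℓ)) ∧
    (Pure K →
      serreDepth k 2 (quotMod k (symbPow (srIdeal k K) (ℓ + 1))) ≤
        serreDepth k 2 (quotMod k (symbPow (srIdeal k K) ℓ))) := by
  have hne : ∀ F, IsFacet K F → F.Nonempty := fun F hF => hF.nonempty_of_dim hdim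
  have hle : ∀ F, IsFacet K F → F.card ≤ 2 := fun F hF => hdim.2 F hF.1
  have hn : 2 ≤ n := by
    obtain ⟨F, hF, h⟩ := hdim.1
    have := Finset.card_le_univ F
    rwa [h, Fintype.card_fin] at this
  have hsucc : 1 ≤ ℓ + 1 := Nat.le_add_left 1 ℓ
  have hmeet : ∀ m, 1 ≤ m → ∃ i, i ≤ 2 ∧
      ¬ ExtZero (MvPolynomial (Fin n) k) (ResField k n) (SymbQuot k K m) i := by
    intro m hm
    by_contra! h
    exact not_extZero_residue_one_and_two k hm hK hne hle ⟨h 1 one_le_two, h 2 le_rfl⟩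
  constructor
  · simp only [mdepth, mem_depth_set_iff hK]
    obtain ⟨i, -, hi⟩ := hmeet ℓ hℓ
    have hmem : sInf {i | ¬ ExtZero (MvPolynomial (Fin n) k) (ResField k n) (SymbQuot k K ℓ) i} ∈
      {i | ¬ ExtZero (MvPolynomial (Fin n) k) (ResField k n) (SymbQuot k K ℓ) i} :=
      Nat.sInf_mem ⟨i, hi⟩
    generalize sInf {i | ¬ ExtZero (MvPolynomial (Fin n) k) (ResField k n) (SymbQuot k K ℓ) i} = m
      at hmem ⊢
    match m, hmem with
    | 0, h => exact (h (extZero_residue_symbQuot_zero k ℓ hne)).elim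
    | 1, h =>
      have hs := hasSplitting_succ (ℓ := ℓ) hK hdim fun hs hcard =>
        h (extZero_residue_symbQuot_one k hs hcard)
      exact Nat.sInf_le (not_extZero_residue_symbQuot_one k hs hne)
    | m + 2, _ =>
      obtain ⟨i, hi, h⟩ := hmeet (ℓ + 1) hsucc
      exact (Nat.sInf_le h).trans (hi.trans (Nat.le_add_left 2 m))
  · intro hpure
    have hcard : ∀ F, IsFacet K F → F.card = 2 := by
      obtain ⟨G, hG, hG2⟩ := exists_facet_card_eq_two hdim
      exact fun F hF => (hpure F G hF hG).trans hG2
    have hmem := Nat.sInf_mem (s := {j : ℕ | ((j + 1 - 2 : ℕ) : WithBot ℕ∞) ≤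
      modDim (serreK k (quotMod k (symbPow (srIdeal k K) ℓ)) j)})
      ⟨2, two_mem_serreDepth_set hℓ hK hdim⟩
    rw [serreDepth, serreDepth]
    generalize sInf {j : ℕ | ((j + 1 - 2 : ℕ) : WithBot ℕ∞) ≤
      modDim (serreK k (quotMod k (symbPow (srIdeal k K) ℓ)) j)} = m at hmem ⊢
    match m, hmem with
    | 0, h =>
      exact ((mem_serreDepth_set_iff hK zero_le_one).mp h (extZero_symbQuot_top k ℓ hne)).elim
    | 1, h =>
      have hs := hasSplitting_succ (ℓ := ℓ) hK hdim fun hs _ =>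
        (mem_serreDepth_set_iff hK le_rfl).mp h (extZero_symbQuot_pred_top k hs hcard hn)
      exact Nat.sInf_le ((mem_serreDepth_set_iff hK le_rfl).mpr
        (not_extZero_symbQuot_pred_top k hs hne (one_le_two.trans hn)))
    | m + 2, _ =>
      exact (Nat.sInf_le (two_mem_serreDepth_set (k := k) hsucc hK hdim)).trans
        (Nat.le_add_left 2 m)

end SerrePaper
end

section
/- Let Δ be a pure simplicial complex. Then the sequence (S_2-depth(S/I_Δ^(ℓ)))_{ℓ≥1} is convergent (i.e., eventually constant), and its limit equals its minimum: min_ℓ S_2-depth(S/I_Δ^(ℓ)) = lim_{ℓ→∞} S_2-depth(S/I_Δ^(ℓ)). -/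
/-!
Common definitions for formalizing "The Serre depth of Stanley–Reisner rings and
the depth of their symbolic powers" (Muta–Terai).
-/

open CategoryTheory MvPolynomial

namespace SerrePaper

theorem smul_homology_eq_zero_iff_s19 {R : Type} [CommRing R] (S : ShortComplex (ModuleCat.{0} R))
    (r : R) :
    (∀ z : S.homology, r • z = 0) ↔ ∀ x : S.X₂, S.g x = 0 → ∃ y : S.X₁, S.f y = r • x := by
  have key : (∀ z : S.homology, r • z = 0) ↔
      ∀ z : S.moduleCatLeftHomologyData.H, r • z = 0 := by
    have e := S.moduleCatHomologyIso.toLinearEquiv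
    exact ⟨fun h z => by rw [← e.apply_symm_apply z, ← map_smul, h, map_zero],
      fun h z => by rw [← e.symm_apply_apply z, ← map_smul, h, map_zero]⟩
  rw [key]
  constructor
  · intro h x hx
    have h2 := h (Submodule.Quotient.mk (⟨x, hx⟩ : LinearMap.ker S.g.hom))
    erw [← Submodule.Quotient.mk_smul, Submodule.Quotient.mk_eq_zero] at h2
    obtain ⟨y, hy⟩ := h2
    exact ⟨y, congrArg Subtype.val hy⟩
  · intro h z
    obtain ⟨⟨x, hx⟩, rfl⟩ := Submodule.Quotient.mk_surjective _ z
    obtain ⟨y, hy⟩ := h x hx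
    erw [← Submodule.Quotient.mk_smul, Submodule.Quotient.mk_eq_zero]
    exact ⟨y, Subtype.ext hy⟩

theorem mem_annihilator_extM_iff {R : Type} [CommRing R] {M : ModuleCat.{0} R}
    (P : ProjectiveResolution M) (N : ModuleCat.{0} R) (i : ℕ) (r : R) :
    r ∈ Module.annihilator R (extM M N i) ↔
      ∀ c : P.complex.X i ⟶ N, P.complex.d (i + 1) i ≫ c = 0 →
        ∃ g : P.complex.X ((ComplexShape.up ℕ).prev i) ⟶ N,
          P.complex.d i ((ComplexShape.up ℕ).prev i) ≫ g = r • c := by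
  have e : extM M N i ≃ₗ[R] (P.complex.linearYonedaObj R N).homology i :=
    (P.isoExt (R := R) i N).toLinearEquiv
  rw [e.annihilator_eq, Module.mem_annihilator]
  refine (smul_homology_eq_zero_iff_s19 ((P.complex.linearYonedaObj R N).sc i) r).trans ?_
  have hn : (ComplexShape.up ℕ).next i = i + 1 := by simp
  change (∀ c : P.complex.X i ⟶ N, P.complex.d ((ComplexShape.up ℕ).next i) i ≫ c = 0 → _) ↔ _
  rw [hn]
  rfl

theorem smul_abelianExt_eq_zero {R : Type} [CommRing R] {M N : ModuleCat.{0} R} {i : ℕ} {r : R}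
    (hr : r ∈ Module.annihilator R (extM M N i)) (e : Abelian.Ext M N i) : r • e = 0 := by
  let P := ProjectiveResolution.of M
  obtain ⟨c, hc, rfl⟩ := P.extMk_surjective e (i + 1) rfl
  obtain ⟨g, hg⟩ := (mem_annihilator_extM_iff P N i r).1 hr c hc
  rw [Abelian.Ext.smul_eq_comp_mk₀, P.extMk_comp_mk₀]
  have h1 : c ≫ (r • 𝟙 N) = r • c := by simp
  cases i with
  | zero =>
    have : P.complex.d 0 ((ComplexShape.up ℕ).prev 0) = 0 :=
      P.complex.shape _ _ (by simp [ComplexShape.down])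
    rw [this, Limits.zero_comp] at hg
    simp only [h1, ← hg, P.extMk_zero]
  | succ p =>
    rw [P.extMk_eq_zero_iff _ _ _ _ p rfl, h1]
    have hp : (ComplexShape.up ℕ).prev (p + 1) = p := by simp
    have h : ∃ g : P.complex.X ((ComplexShape.up ℕ).prev (p + 1)) ⟶ N,
        P.complex.d (p + 1) ((ComplexShape.up ℕ).prev (p + 1)) ≫ g = r • c := ⟨g, hg⟩
    rwa [hp] at h

theorem annihilator_extM_le_of_retract {R : Type} [CommRing R] {M M' : ModuleCat.{0} R}
    (a : M ⟶ M') (b : M' ⟶ M) (hab : a ≫ b = 𝟙 M) (N : ModuleCat.{0} R) (i : ℕ) :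
    Module.annihilator R (extM M' N i) ≤ Module.annihilator R (extM M N i) := by
  let F := (Ext R (ModuleCat.{0} R) i).flip.obj N
  refine LinearMap.annihilator_le_of_injective (F.map b.op).hom ?_
  refine Function.LeftInverse.injective (g := (F.map a.op).hom) fun z => ?_
  have : F.map b.op ≫ F.map a.op = 𝟙 _ := by
    rw [← F.map_comp, ← op_comp, hab, op_id, F.map_id]
  exact congr($(this).hom z)

theorem ringKrullDim_le_of_isIntegral {A B : Type} [CommRing A] [CommRing B] [Algebra A B]
    [Algebra.IsIntegral A B] (h : Function.Injective (algebraMap A B)) :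
    ringKrullDim A ≤ ringKrullDim B := by
  refine iSup_le fun p => ?_
  obtain ⟨q, hq, -⟩ : ∃ q : LTSeries (PrimeSpectrum B), q.length = p.length ∧
      q.last.asIdeal.comap (algebraMap A B) = p.last.asIdeal := by
    induction p using RelSeries.inductionOn' with
    | singleton x =>
      obtain ⟨Q, -, hQ, hQx⟩ := Ideal.exists_ideal_over_prime_of_isIntegral (S := B) x.asIdeal ⊥
        (by rw [← RingHom.ker_eq_comap_bot, (RingHom.injective_iff_ker_eq_bot _).1 h]; exact bot_le)
      exact ⟨RelSeries.singleton _ ⟨Q, hQ⟩, rfl, hQx⟩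
    | snoc p x hx ih =>
      obtain ⟨q, hql, hq⟩ := ih
      have hlt : p.last.asIdeal < x.asIdeal := hx
      obtain ⟨Q, hle, hQ, hQx⟩ := Ideal.exists_ideal_over_prime_of_isIntegral (S := B) x.asIdeal
        q.last.asIdeal (hq.trans_le hlt.le)
      refine ⟨q.snoc ⟨Q, hQ⟩ (lt_of_le_of_ne hle ?_), by simp [hql], by simpa using hQx⟩
      intro he
      rw [he, hQx] at hq
      exact hlt.ne hq.symm
  rw [← hq]
  exact le_iSup (fun q : LTSeries (PrimeSpectrum B) => (q.length : WithBot ℕ∞)) q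

theorem ringKrullDim_quotient_comap_le {A B : Type} [CommRing A] [CommRing B] (f : A →+* B)
    (hf : f.IsIntegral) (J : Ideal B) : ringKrullDim (A ⧸ J.comap f) ≤ ringKrullDim (B ⧸ J) := by
  let g : A ⧸ J.comap f →+* B ⧸ J := Ideal.quotientMap J f le_rfl
  have hg : g.IsIntegral := by
    refine RingHom.IsIntegral.tower_top (Ideal.Quotient.mk _) g ?_
    rw [Ideal.quotientMap_comp_mk]
    exact hf.trans _ _ (RingHom.isIntegral_of_surjective _ Ideal.Quotient.mk_surjective)
  algebraize [g]
  exact ringKrullDim_le_of_isIntegral Ideal.quotientMap_injective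

/-- An `A`-linear form `form : B → A` along `f : A →+* B`, with a finite generating family `gen` of
`B` over `A` whose dual family with respect to `form` is a permutation of `gen`. -/
structure FrobeniusForm {A B : Type} [CommRing A] [CommRing B] (f : A →+* B) where
  form : B →+ A
  form_mul : ∀ a b, form (f a * b) = a * form b
  ι : Type
  fintype : Fintype ι
  gen : ι → B
  perm : Equiv.Perm ι
  perm_perm : ∀ r, perm (perm r) = r
  sum_form_mul_gen : ∀ s, ∑ r, f (form (gen (perm r) * s)) * gen r = s

namespace FrobeniusForm

attribute [instance] FrobeniusForm.fintype

variable {A B : Type} [CommRing A] [CommRing B] {f : A →+* B}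

theorem finite (T : FrobeniusForm f) : f.Finite := by
  algebraize [f]
  refine Module.Finite.of_surjective (Fintype.linearCombination A T.gen) fun s => ?_
  refine ⟨fun r => T.form (T.gen (T.perm r) * s), ?_⟩
  simp only [Fintype.linearCombination_apply, Algebra.smul_def]
  exact T.sum_form_mul_gen s

theorem preservesEpimorphisms_coextendScalars (T : FrobeniusForm f) :
    (ModuleCat.coextendScalars.{0, 0, 0} f).PreservesEpimorphisms where
  preserves {X Y} h hh := by
    rw [ModuleCat.epi_iff_surjective] at hh ⊢
    intro u
    choose x hx using fun r => hh (ModuleCat.CoextendScalars.equiv f Y u (T.gen r))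
    have hadd (s s' : B) : ∑ r, T.form (T.gen (T.perm r) * (s + s')) • x r =
        ∑ r, T.form (T.gen (T.perm r) * s) • x r + ∑ r, T.form (T.gen (T.perm r) * s') • x r := by
      simp only [mul_add, map_add, add_smul, Finset.sum_add_distrib]
    have hsmul (a : A) (s : B) : ∑ r, T.form (T.gen (T.perm r) * (f a * s)) • x r =
        a • ∑ r, T.form (T.gen (T.perm r) * s) • x r := by
      simp only [mul_left_comm _ (f a), T.form_mul, mul_smul, Finset.smul_sum]
    refine ⟨(ModuleCat.CoextendScalars.equiv f X).symm
      { toFun s := ∑ r, T.form (T.gen (T.perm r) * (show B from s)) • x r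
        map_add' := hadd
        map_smul' := hsmul }, ?_⟩
    ext s
    change h.hom (∑ r, T.form (T.gen (T.perm r) * (show B from s)) • x r) =
      ModuleCat.CoextendScalars.equiv f Y u s
    have hs (r : T.ι) : T.form (T.gen (T.perm r) * (show B from s)) • h.hom (x r) =
        ModuleCat.CoextendScalars.equiv f Y u
          (show B from f (T.form (T.gen (T.perm r) * (show B from s))) * T.gen r) := by
      rw [show h.hom (x r) = _ from hx r]
      exact (map_smul (ModuleCat.CoextendScalars.equiv f Y u) _ _).symm
    simp only [map_sum, map_smul, hs]
    conv_rhs => rw [← T.sum_form_mul_gen s]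
    exact (map_sum (ModuleCat.CoextendScalars.equiv f Y u) _ _).symm

theorem preservesProjectiveObjects_restrictScalars (T : FrobeniusForm f) :
    (ModuleCat.restrictScalars.{0} f).PreservesProjectiveObjects := by
  have := T.preservesEpimorphisms_coextendScalars
  exact Functor.preservesProjectiveObjects_of_adjunction_of_preservesEpimorphisms
    (ModuleCat.restrictCoextendScalarsAdj.{0, 0, 0} f)

/-- The `B`-linear map to `B` corresponding to an `A`-linear map to `A`. -/
def lift (T : FrobeniusForm f) {Q : Type} [AddCommGroup Q] [Module B Q] (c : Q →+ A)
    (hc : ∀ a n, c (f a • n) = a * c n) : Q →ₗ[B] B where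
  toFun n := ∑ r, f (c (T.gen (T.perm r) • n)) * T.gen r
  map_add' x y := by simp [add_mul, Finset.sum_add_distrib]
  map_smul' s n := by
    have h1 (r : T.ι) : c (T.gen (T.perm r) • s • n) =
        ∑ q, T.form (T.gen (T.perm q) * (T.gen (T.perm r) * s)) * c (T.gen q • n) := by
      conv_lhs => rw [smul_smul, ← T.sum_form_mul_gen (T.gen (T.perm r) * s), Finset.sum_smul,
        map_sum]
      simp only [mul_smul, hc]
    simp only [h1, map_sum, Finset.sum_mul, map_mul, RingHom.id_apply, smul_eq_mul, Finset.mul_sum]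
    rw [Finset.sum_comm, ← Equiv.sum_comp T.perm]
    refine Finset.sum_congr rfl fun q _ => ?_
    simp only [T.perm_perm]
    conv_rhs => rw [mul_left_comm, ← T.sum_form_mul_gen (s * T.gen q), Finset.mul_sum]
    refine Finset.sum_congr rfl fun r _ => ?_
    rw [show T.gen q * (T.gen (T.perm r) * s) = T.gen (T.perm r) * (s * T.gen q) by ring]
    ring

theorem form_lift (T : FrobeniusForm f) {Q : Type} [AddCommGroup Q] [Module B Q] (c : Q →+ A)
    (hc : ∀ a n, c (f a • n) = a * c n) (n : Q) : T.form (T.lift c hc n) = c n := by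
  conv_rhs => rw [← one_smul B n, ← T.sum_form_mul_gen 1, Finset.sum_smul, map_sum]
  rw [← Equiv.sum_comp T.perm]
  simp only [lift, LinearMap.coe_mk, AddHom.coe_mk, map_sum, T.form_mul, mul_smul, hc, mul_one,
    T.perm_perm]
  exact Finset.sum_congr rfl fun r _ => mul_comm _ _

theorem comap_annihilator_extM_le (T : FrobeniusForm f) (M : ModuleCat.{0} B) (i : ℕ) :
    (Module.annihilator B (extM M (ModuleCat.of B B) i)).comap f ≤
      Module.annihilator A
        (extM ((ModuleCat.restrictScalars.{0} f).obj M) (ModuleCat.of A A) i) := by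
  intro r hr
  have := T.preservesProjectiveObjects_restrictScalars
  let P := ProjectiveResolution.of M
  rw [Ideal.mem_comap, mem_annihilator_extM_iff P] at hr
  rw [mem_annihilator_extM_iff ((ModuleCat.restrictScalars.{0} f).mapProjectiveResolution P)]
  intro c hc
  change (ModuleCat.restrictScalars.{0} f).obj (P.complex.X i) ⟶ ModuleCat.of A A at c
  let c' : P.complex.X i →+ A := AddMonoidHomClass.toAddMonoidHom c.hom
  have hc' (a : A) (n : P.complex.X i) : c' (f a • n) = a * c' n := c.hom.map_smul a n
  have hcd (x : P.complex.X (i + 1)) : c' (P.complex.d (i + 1) i x) = 0 :=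
    congr($(hc).hom x)
  obtain ⟨g, hg⟩ := hr (ModuleCat.ofHom (T.lift c' hc')) <| by
    ext x
    change ∑ r, f (c' (T.gen (T.perm r) • P.complex.d (i + 1) i x)) * T.gen r = 0
    simp only [← map_smul, hcd, map_zero, zero_mul, Finset.sum_const_zero]
  have hadd (x y : P.complex.X ((ComplexShape.up ℕ).prev i)) :
      T.form (g.hom (x + y)) = T.form (g.hom x) + T.form (g.hom y) := by
    rw [map_add]
    exact map_add _ _ _
  have hsmul (a : A) (x : P.complex.X ((ComplexShape.up ℕ).prev i)) :
      T.form (g.hom (f a • x)) = a * T.form (g.hom x) := by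
    rw [map_smul]
    exact T.form_mul _ _
  have hcomp (x : P.complex.X i) : T.form (g.hom (P.complex.d i _ x)) = r * c' x := by
    have h1 : g.hom (P.complex.d i _ x) = f r • T.lift c' hc' x := congr($(hg).hom x)
    rw [h1, smul_eq_mul]
    exact (T.form_mul _ _).trans (congrArg _ (T.form_lift _ _ _))
  refine ⟨ModuleCat.ofHom (X := (ModuleCat.restrictScalars.{0} f).obj
    (P.complex.X ((ComplexShape.up ℕ).prev i)))
    { toFun x := T.form (g.hom x)
      map_add' := hadd
      map_smul' := hsmul }, ?_⟩
  ext x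
  exact hcomp x

end FrobeniusForm

theorem comap_annihilator_extM_quotient_le {A : Type} [CommRing A] {f : A →+* A}
    (T : FrobeniusForm f) (D : A →+ A) (hD : ∀ a b, D (f a * b) = a * D b) (hD1 : D 1 = 1)
    {I J : Ideal A} (hIJ : ∀ x ∈ I, f x ∈ J) (hJI : ∀ x ∈ J, D x ∈ I) (i : ℕ) :
    (Module.annihilator A (extM (ModuleCat.of A (A ⧸ J)) (ModuleCat.of A A) i)).comap f ≤
      Module.annihilator A (extM (ModuleCat.of A (A ⧸ I)) (ModuleCat.of A A) i) := by
  refine (T.comap_annihilator_extM_le (ModuleCat.of A (A ⧸ J)) i).trans ?_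
  let a : A ⧸ I →+ A ⧸ J := (Ideal.quotientMap J f hIJ : A ⧸ I →+* A ⧸ J)
  let b : A ⧸ J →+ A ⧸ I := QuotientAddGroup.map _ _ D hJI
  have ha (r : A) (x : A ⧸ I) : a (r • x) = f r • a x := by
    obtain ⟨x, rfl⟩ := Ideal.Quotient.mk_surjective x
    exact congrArg (Ideal.Quotient.mk J) (map_mul f r x)
  have hb (r : A) (x : A ⧸ J) : b (f r • x) = r • b x := by
    obtain ⟨x, rfl⟩ := Ideal.Quotient.mk_surjective x
    exact congrArg (Ideal.Quotient.mk I) (hD r x)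
  have hab (x : A ⧸ I) : b (a x) = x := by
    obtain ⟨x, rfl⟩ := Ideal.Quotient.mk_surjective x
    refine congrArg (Ideal.Quotient.mk I) ((congrArg D (mul_one (f x)).symm).trans ?_)
    rw [hD, hD1, mul_one]
  refine annihilator_extM_le_of_retract
    (M' := (ModuleCat.restrictScalars.{0} f).obj (ModuleCat.of A (A ⧸ J)))
    (ModuleCat.ofHom (Y := (ModuleCat.restrictScalars.{0} f).obj (ModuleCat.of A (A ⧸ J)))
      { toFun := a, map_add' := map_add a, map_smul' := ha })
    (ModuleCat.ofHom (X := (ModuleCat.restrictScalars.{0} f).obj (ModuleCat.of A (A ⧸ J)))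
      { toFun := b, map_add' := map_add b, map_smul' := hb }) ?_ _ _
  refine ModuleCat.hom_ext (LinearMap.ext fun x => ?_)
  exact hab x

noncomputable section Digit

variable {σ k : Type} [Fintype σ] [Field k]

open Classical in
/-- The linear map sending the monomial `x ^ u` to `x ^ (u / t)` if `u` is congruent to `w`
modulo `t`, and to `0` otherwise. -/
def digit (t : ℕ) (w : σ → ℕ) : MvPolynomial σ k →ₗ[k] MvPolynomial σ k :=
  (basisMonomials σ k).constr k fun u =>
    if ∀ i, u i % t = w i then monomial (u.mapRange (· / t) (Nat.zero_div t)) 1 else 0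

open Classical in
theorem digit_monomial (t : ℕ) (w : σ → ℕ) (u : σ →₀ ℕ) (c : k) :
    digit t w (monomial u c) =
      if ∀ i, u i % t = w i then monomial (u.mapRange (· / t) (Nat.zero_div t)) c else 0 := by
  have h : (monomial u c : MvPolynomial σ k) = c • basisMonomials σ k u := by
    simp [smul_monomial]
  rw [h, map_smul, digit, Module.Basis.constr_basis]
  split_ifs <;> simp [smul_monomial]

theorem digit_expand_mul {t : ℕ} (ht : 0 < t) (w : σ → ℕ) (a b : MvPolynomial σ k) :
    digit t w (expand t a * b) = a * digit t w b := by
  classical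
  induction a using MvPolynomial.induction_on' with
  | add p q hp hq => simp only [map_add, add_mul, hp, hq]
  | monomial m c =>
    induction b using MvPolynomial.induction_on' with
    | add p q hp hq => simp only [map_add, mul_add, hp, hq]
    | monomial u d =>
      rw [expand_monomial, monomial_mul, digit_monomial, digit_monomial, mul_ite, mul_zero,
        monomial_mul]
      refine if_congr (by simp) ?_ rfl
      congr 2
      ext i
      simp [Nat.mul_add_div ht]

theorem digit_monomial_mul {t : ℕ} (r : σ → Fin t) (s : MvPolynomial σ k) :
    digit t (fun _ => t - 1)
        (monomial (Finsupp.equivFunOnFinite.symm fun i => ((r i).rev : ℕ)) 1 * s) =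
      digit t (fun i => r i) s := by
  classical
  induction s using MvPolynomial.induction_on' with
  | add p q hp hq => simp only [map_add, mul_add, hp, hq]
  | monomial u d =>
    have key (i : σ) : ((((r i).rev : ℕ) + u i) % t = t - 1 ↔ u i % t = r i) ∧
        (u i % t = r i → (((r i).rev : ℕ) + u i) / t = u i / t) := by
      have h1 := (r i).isLt
      have h2 : ((r i).rev : ℕ) = t - 1 - r i := by rw [Fin.val_rev]; omega
      have h3 := Nat.mod_lt (u i) (show t > 0 by omega)
      have h4 := Nat.div_add_mod (u i) t
      generalize u i % t = v at *
      generalize u i / t = q at *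
      rw [h2, ← h4]
      rw [show t - 1 - (r i : ℕ) + (t * q + v) = t * q + (t - 1 - (r i : ℕ) + v) by ring,
        Nat.mul_add_mod, Nat.mul_add_div (by omega)]
      rcases lt_or_ge (t - 1 - (r i : ℕ) + v) t with h | h
      · rw [Nat.mod_eq_of_lt h, Nat.div_eq_of_lt h]
        omega
      · rw [Nat.mod_eq_sub_mod h, Nat.mod_eq_of_lt (by omega)]
        omega
    rw [monomial_mul, digit_monomial, digit_monomial]
    simp only [Finsupp.add_apply, Finsupp.equivFunOnFinite_symm_apply_apply, one_mul, (key _).1]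
    split_ifs with h
    · congr 2
      ext i
      simpa using (key i).2 (h i)
    · rfl

variable [DecidableEq σ]

theorem sum_expand_digit_mul {t : ℕ} (ht : 0 < t) (s : MvPolynomial σ k) :
    ∑ r : σ → Fin t, expand t (digit t (fun i => r i) s) *
      monomial (Finsupp.equivFunOnFinite.symm fun i => (r i : ℕ)) 1 = s := by
  classical
  induction s using MvPolynomial.induction_on' with
  | add p q hp hq => simp only [map_add, add_mul, Finset.sum_add_distrib, hp, hq]
  | monomial u d =>
    rw [Finset.sum_eq_single fun i => (⟨u i % t, Nat.mod_lt _ ht⟩ : Fin t)]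
    · rw [digit_monomial, if_pos fun _ => rfl, expand_monomial, monomial_mul, mul_one]
      congr 2
      ext i
      simp [Nat.div_add_mod]
    · intro r _ hr
      rw [digit_monomial, if_neg, map_zero, zero_mul]
      exact fun h => hr (funext fun i => Fin.ext (h i).symm)
    · simp

/-- The substitution `x_i ↦ x_i ^ t` makes the polynomial ring a Frobenius extension of itself. -/
def expandFrobeniusForm {t : ℕ} (ht : 0 < t) :
    FrobeniusForm (expand t : MvPolynomial σ k →ₐ[k] MvPolynomial σ k).toRingHom where
  form := (digit t fun _ => t - 1 : MvPolynomial σ k →ₗ[k] MvPolynomial σ k)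
  form_mul a b := digit_expand_mul ht _ a b
  ι := σ → Fin t
  fintype := inferInstance
  gen r := monomial (Finsupp.equivFunOnFinite.symm fun i => (r i : ℕ)) 1
  perm := Equiv.piCongrRight fun _ => Fin.revPerm
  perm_perm r := by ext; simp
  sum_form_mul_gen s := by
    conv_rhs => rw [← sum_expand_digit_mul ht s]
    refine Finset.sum_congr rfl fun r _ => ?_
    rw [← digit_monomial_mul r s]
    rfl

end Digit

noncomputable section VarIdeal

variable {σ k : Type} [Field k]

variable (k) in
/-- The prime ideal generated by the variables indexed by `T`. -/
def varIdeal (T : Finset σ) : Ideal (MvPolynomial σ k) :=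
  Ideal.span (X '' (T : Set σ))

theorem mem_varIdeal_iff {T : Finset σ} {p : MvPolynomial σ k} :
    p ∈ varIdeal k T ↔ ∀ m ∈ p.support, ∃ i ∈ T, m i ≠ 0 := by
  simp [varIdeal, mem_ideal_span_X_image]

theorem X_mem_varIdeal {T : Finset σ} {i : σ} (hi : i ∈ T) : X i ∈ varIdeal k T :=
  Ideal.subset_span ⟨i, hi, rfl⟩

open Classical in
variable (k) in
/-- Setting the variables indexed by `T` to zero. -/
def eraseVars (T : Finset σ) : MvPolynomial σ k →ₐ[k] MvPolynomial {i // i ∉ T} k :=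
  aeval fun i => if h : i ∉ T then X ⟨i, h⟩ else 0

theorem eraseVars_surjective (T : Finset σ) : Function.Surjective (eraseVars k T) := by
  have h : (eraseVars k T).comp (rename Subtype.val) = AlgHom.id k _ := by
    ext1 i
    simp [eraseVars, i.2]
  exact fun p => ⟨rename Subtype.val p, DFunLike.congr_fun h p⟩

theorem ker_eraseVars (T : Finset σ) : RingHom.ker (eraseVars k T) = varIdeal k T := by
  refine le_antisymm (fun p hp => ?_) ?_
  · have h : (Ideal.Quotient.mkₐ k (varIdeal k T)).comp
        ((rename Subtype.val).comp (eraseVars k T)) = Ideal.Quotient.mkₐ k (varIdeal k T) := by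
      ext1 i
      by_cases hi : i ∈ T
      · have : Ideal.Quotient.mk (varIdeal k T) (X i) = 0 :=
          Ideal.Quotient.eq_zero_iff_mem.mpr (X_mem_varIdeal hi)
        simp [eraseVars, hi, this]
      · simp [eraseVars, hi]
    have h1 := DFunLike.congr_fun h p
    rw [RingHom.mem_ker] at hp
    simp only [AlgHom.comp_apply, hp, map_zero] at h1
    exact Ideal.Quotient.eq_zero_iff_mem.mp h1.symm
  · rw [varIdeal, Ideal.span_le]
    rintro _ ⟨i, hi, rfl⟩
    have hi : i ∈ T := hi
    simp [eraseVars, hi]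

theorem isPrime_varIdeal (T : Finset σ) : (varIdeal k T).IsPrime := by
  rw [← ker_eraseVars]
  exact RingHom.ker_isPrime _

theorem X_mem_varIdeal_iff {T : Finset σ} {i : σ} : X i ∈ varIdeal k T ↔ i ∈ T := by
  rw [← ker_eraseVars, RingHom.mem_ker]
  by_cases hi : i ∈ T <;> simp [eraseVars, hi]

theorem le_sum_of_mem_varIdeal_pow {T : Finset σ} {N : ℕ} {p : MvPolynomial σ k}
    (hp : p ∈ varIdeal k T ^ N) {m : σ →₀ ℕ} (hm : m ∈ p.support) : N ≤ ∑ i ∈ T, m i := by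
  classical
  induction N generalizing p m with
  | zero => exact Nat.zero_le _
  | succ N ih =>
    rw [pow_succ] at hp
    induction hp using Submodule.mul_induction_on' generalizing m with
    | mem_mul_mem a ha b hb =>
      obtain ⟨u, hu, v, hv, rfl⟩ := Finset.mem_add.mp (support_mul a b hm)
      obtain ⟨i, hi, hvi⟩ := mem_varIdeal_iff.mp hb v hv
      have h1 := ih ha hu
      have h2 := Finset.single_le_sum (f := v) (fun _ _ => Nat.zero_le _) hi
      simp only [Finsupp.add_apply, Finset.sum_add_distrib]
      omega
    | add a _ b _ iha ihb =>
      rcases Finset.mem_union.mp (support_add hm) with h | h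
      exacts [iha h, ihb h]

theorem monomial_mem_varIdeal_pow {T : Finset σ} {N : ℕ} {m : σ →₀ ℕ} (hm : N ≤ ∑ i ∈ T, m i)
    (c : k) : monomial m c ∈ varIdeal k T ^ N := by
  classical
  have h1 : ∏ i ∈ T, X i ^ m i ∈ ∏ i ∈ T, varIdeal k T ^ m i :=
    Ideal.prod_mem_prod fun i hi => Ideal.pow_mem_pow (X_mem_varIdeal hi) _
  rw [Finset.prod_pow_eq_pow_sum] at h1
  refine Ideal.mem_of_dvd _ ?_ (Ideal.pow_le_pow_right hm h1)
  rw [monomial_eq]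
  refine Dvd.dvd.mul_left ?_ _
  rw [Finsupp.prod]
  have h2 : ∏ i ∈ T, (X i : MvPolynomial σ k) ^ m i = ∏ i ∈ T with i ∈ m.support, X i ^ m i := by
    rw [Finset.prod_filter]
    refine Finset.prod_congr rfl fun i _ => ?_
    split_ifs with h
    · rfl
    · rw [Finsupp.notMem_support_iff.mp h, pow_zero]
  rw [h2]
  exact Finset.prod_dvd_prod_of_subset _ _ _ fun i hi => (Finset.mem_filter.mp hi).2

theorem expand_mem_varIdeal_pow {T : Finset σ} {t l l' : ℕ} (h : l' ≤ t * l)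
    {p : MvPolynomial σ k} (hp : p ∈ varIdeal k T ^ l) : expand t p ∈ varIdeal k T ^ l' := by
  have h1 : (varIdeal k T).map (expand t) ≤ varIdeal k T ^ t := by
    rw [varIdeal, Ideal.map_span, Ideal.span_le]
    rintro _ ⟨_, ⟨i, hi, rfl⟩, rfl⟩
    rw [expand_X]
    exact Ideal.pow_mem_pow (X_mem_varIdeal hi) _
  have h2 := Ideal.mem_map_of_mem (expand t) hp
  rw [Ideal.map_pow] at h2
  have h3 := Ideal.pow_right_mono h1 l h2
  rw [← pow_mul] at h3
  exact Ideal.pow_le_pow_right h h3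

theorem digit_mem_varIdeal_pow [Fintype σ] {T : Finset σ} {t l l' : ℕ} (h : t * l < l' + t)
    {p : MvPolynomial σ k} (hp : p ∈ varIdeal k T ^ l') :
    digit t (fun _ => 0) p ∈ varIdeal k T ^ l := by
  classical
  rw [p.as_sum, map_sum]
  refine Ideal.sum_mem _ fun u hu => ?_
  rw [digit_monomial]
  split_ifs with hut
  · refine monomial_mem_varIdeal_pow ?_ _
    have h1 := le_sum_of_mem_varIdeal_pow hp hu
    have h2 : ∑ i ∈ T, u i = t * ∑ i ∈ T, u.mapRange (· / t) (Nat.zero_div t) i := by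
      rw [Finset.mul_sum]
      exact Finset.sum_congr rfl fun i _ => by
        simpa using (Nat.mul_div_cancel' (Nat.dvd_of_mod_eq_zero (hut i))).symm
    rw [h2] at h1
    by_contra! hlt
    have h3 := Nat.mul_le_mul_left t (Nat.succ_le_of_lt hlt)
    rw [Nat.mul_succ] at h3
    omega
  · exact zero_mem _

/-- Every minimal prime of a squarefree monomial ideal is generated by variables. -/
theorem exists_eq_varIdeal_of_mem_minimalPrimes [Finite σ] {K : Set (Finset σ)}
    {P : Ideal (MvPolynomial σ k)} (hP : P ∈ (srIdeal k K).minimalPrimes) :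
    ∃ T : Finset σ, P = varIdeal k T := by
  classical
  have := Fintype.ofFinite σ
  have hprime := hP.1.1
  let T : Finset σ := {i | X i ∈ P}
  have hTP : varIdeal k T ≤ P := by
    rw [varIdeal, Ideal.span_le]
    rintro _ ⟨i, hi, rfl⟩
    simpa [T] using hi
  refine ⟨T, le_antisymm (hP.2 ⟨isPrime_varIdeal T, ?_⟩ hTP) hTP⟩
  rw [srIdeal, Ideal.span_le]
  rintro _ ⟨F, hF, rfl⟩
  obtain ⟨i, hi, hiP⟩ := hprime.prod_mem_iff.mp (hP.1.2 (Ideal.subset_span ⟨F, hF, rfl⟩))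
  exact Ideal.mem_of_dvd _ (Finset.dvd_prod_of_mem _ hi)
    (Ideal.subset_span ⟨i, by simpa [T] using hiP, rfl⟩)

theorem mem_symbPow_iff {R : Type} [CommRing R] {I : Ideal R} {l : ℕ} {x : R} :
    x ∈ symbPow I l ↔ ∀ P ∈ I.minimalPrimes, x ∈ P ^ l := by
  simp only [symbPow, Submodule.mem_sInf, Set.mem_ofPred_eq, forall_exists_index, and_imp]
  exact ⟨fun h P hP => h _ P hP rfl, fun h _ P hP e => e ▸ h P hP⟩

theorem modDim_serreK_symbPow_le [Fintype σ] (K : Set (Finset σ)) {t l l' : ℕ} (ht : 0 < t)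
    (h1 : l' ≤ t * l) (h2 : t * l < l' + t) (j : ℕ) :
    modDim (serreK k (quotMod k (symbPow (srIdeal k K) l)) j) ≤
      modDim (serreK k (quotMod k (symbPow (srIdeal k K) l')) j) := by
  classical
  have T := expandFrobeniusForm (σ := σ) (k := k) ht
  have key := comap_annihilator_extM_quotient_le T (digit t fun _ => 0).toAddMonoidHom
    (fun a b => digit_expand_mul ht _ a b)
    (by simpa using digit_monomial (k := k) (σ := σ) t (fun _ => 0) 0 1)
    (I := symbPow (srIdeal k K) l) (J := symbPow (srIdeal k K) l')
    (fun x hx => mem_symbPow_iff.mpr fun P hP => by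
      obtain ⟨T, rfl⟩ := exists_eq_varIdeal_of_mem_minimalPrimes hP
      exact expand_mem_varIdeal_pow h1 (mem_symbPow_iff.mp hx _ hP))
    (fun x hx => mem_symbPow_iff.mpr fun P hP => by
      obtain ⟨T, rfl⟩ := exists_eq_varIdeal_of_mem_minimalPrimes hP
      exact digit_mem_varIdeal_pow h2 (mem_symbPow_iff.mp hx _ hP))
    (Nat.card σ - j)
  exact (ringKrullDim_le_of_surjective _ (Ideal.Quotient.factor_surjective key)).trans
    (ringKrullDim_quotient_comap_le _ T.finite.to_isIntegral _)

end VarIdeal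

section Ext

open Abelian

/-- `Ext^i(M, N)` vanishes for `i > h` and is isomorphic to `R ⧸ I` for `i = h`. -/
structure TopExtCyclic {R : Type} [CommRing R] (M N : ModuleCat.{0} R) (I : Ideal R) (h : ℕ) :
    Prop where
  eq_zero : ∀ i, h < i → ∀ e : Abelian.Ext M N i, e = 0
  exists_generator : ∃ e : Abelian.Ext M N h,
    (∀ r : R, r • e = 0 ↔ r ∈ I) ∧ ∀ e', ∃ r : R, e' = r • e

theorem topExtCyclic_quotient_bot (R : Type) [CommRing R] :
    TopExtCyclic (ModuleCat.of R (R ⧸ (⊥ : Ideal R))) (ModuleCat.of R R) ⊥ 0 where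
  eq_zero i hi e := by
    have : Module.Projective R (R ⧸ (⊥ : Ideal R)) :=
      Module.Projective.of_equiv (Submodule.quotEquivOfEqBot (⊥ : Ideal R) rfl).symm
    obtain ⟨i, rfl⟩ := Nat.exists_eq_succ_of_ne_zero hi.ne'
    exact Ext.eq_zero_of_projective e
  exists_generator := by
    let φ : R ⧸ (⊥ : Ideal R) →ₗ[R] R := (Submodule.quotEquivOfEqBot (⊥ : Ideal R) rfl).toLinearMap
    have hφ (a : R) : φ (Ideal.Quotient.mk ⊥ a) = a := rfl
    refine ⟨Ext.mk₀ (ModuleCat.ofHom φ), fun r => ?_, fun e' => ?_⟩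
    · rw [← Ext.mk₀_smul, Ext.mk₀_eq_zero_iff, Ideal.mem_bot]
      refine ⟨fun h => ?_, ?_⟩
      · have h1 : r • φ (Ideal.Quotient.mk ⊥ 1) = 0 := congr($(h).hom (Ideal.Quotient.mk ⊥ 1))
        rwa [hφ, smul_eq_mul, mul_one] at h1
      · rintro rfl
        exact zero_smul _ _
    · obtain ⟨f, rfl⟩ := Ext.homEquiv₀.symm.surjective e'
      refine ⟨f.hom (Ideal.Quotient.mk ⊥ 1), ?_⟩
      rw [← Ext.mk₀_smul]
      refine congrArg Ext.mk₀ (ModuleCat.hom_ext (LinearMap.ext fun x => ?_))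
      obtain ⟨x, rfl⟩ := Ideal.Quotient.mk_surjective x
      change f.hom (Ideal.Quotient.mk ⊥ x) =
        f.hom (Ideal.Quotient.mk ⊥ 1) * φ (Ideal.Quotient.mk ⊥ x)
      rw [hφ, mul_comm, ← smul_eq_mul, ← map_smul]
      exact congrArg (fun y => f.hom (Ideal.Quotient.mk ⊥ y)) (mul_one x).symm

theorem TopExtCyclic.of_shortExact {R : Type} [CommRing R] {M M' N : ModuleCat.{0} R} {I : Ideal R}
    {h : ℕ} (H : TopExtCyclic M N I h) {x : R} {g : M ⟶ M'} (w : (x • 𝟙 M) ≫ g = 0)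
    (hS : (ShortComplex.mk (x • 𝟙 M) g w).ShortExact) :
    TopExtCyclic M' N (Ideal.span {x} ⊔ I) (h + 1) := by
  obtain ⟨e, he, hgen⟩ := H.exists_generator
  have hlift (i : ℕ) (hi : h ≤ i) (e' : Abelian.Ext M' N (i + 1)) :
      ∃ e₁ : Abelian.Ext M N i, hS.extClass.comp e₁ (add_comm 1 i) = e' :=
    Ext.contravariant_sequence_exact₃ hS _ e' (H.eq_zero _ (by omega) _) _
  have hx (e₁ : Abelian.Ext M N h) :
      (Ext.mk₀ (x • 𝟙 M)).comp e₁ (zero_add h) = x • e₁ := by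
    rw [Ext.mk₀_smul, Ext.smul_comp, Ext.mk₀_id_comp]
  refine ⟨fun i hi e' => ?_, hS.extClass.comp e (add_comm 1 h), fun r => ?_, fun e' => ?_⟩
  · obtain ⟨i, rfl⟩ := Nat.exists_eq_succ_of_ne_zero (Nat.ne_zero_of_lt hi)
    obtain ⟨e₁, rfl⟩ := hlift i (by omega) e'
    rw [H.eq_zero i (by omega) e₁, Ext.comp_zero]
  · rw [← Ext.comp_smul, Ideal.mem_span_singleton_sup]
    constructor
    · intro hr
      obtain ⟨e₂, he₂⟩ := Ext.contravariant_sequence_exact₁ hS _ _ _ hr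
      obtain ⟨s, rfl⟩ := hgen e₂
      refine ⟨s, r - s * x, ?_, by ring⟩
      rw [← he, sub_smul, ← he₂, sub_eq_zero, mul_comm, mul_smul]
      exact hx (s • e)
    · rintro ⟨s, a, ha, rfl⟩
      rw [add_smul, (he a).mpr ha, add_zero, mul_comm, mul_smul, ← hx]
      exact hS.extClass_comp_assoc _
  · obtain ⟨e₁, rfl⟩ := hlift h le_rfl e'
    obtain ⟨r, rfl⟩ := hgen e₁
    exact ⟨r, Ext.comp_smul _ _ _ _⟩

theorem TopExtCyclic.quotient_sup_span {R : Type} [CommRing R] {N : ModuleCat.{0} R} {I : Ideal R}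
    {h : ℕ} (H : TopExtCyclic (ModuleCat.of R (R ⧸ I)) N I h) {x : R}
    (hx : ∀ a, x * a ∈ I → a ∈ I) :
    TopExtCyclic (ModuleCat.of R (R ⧸ Ideal.span {x} ⊔ I)) N (Ideal.span {x} ⊔ I) (h + 1) := by
  have hle : I ≤ Ideal.span {x} ⊔ I := le_sup_right
  let g : R ⧸ I →ₗ[R] R ⧸ Ideal.span {x} ⊔ I := Submodule.factor hle
  have hg (a : R) : g (Ideal.Quotient.mk I a) = Ideal.Quotient.mk _ a := rfl
  refine H.of_shortExact (x := x) (g := ModuleCat.ofHom g) ?_ ?_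
  · refine ModuleCat.hom_ext (LinearMap.ext fun y => ?_)
    obtain ⟨y, rfl⟩ := Ideal.Quotient.mk_surjective y
    change Ideal.Quotient.mk (Ideal.span {x} ⊔ I) (x * y) = 0
    exact Ideal.Quotient.eq_zero_iff_mem.mpr (Ideal.mul_mem_right _ _
      (Ideal.mem_sup_left (Ideal.mem_span_singleton_self x)))
  · refine { exact := ?_, mono_f := ?_, epi_g := ?_ }
    · rw [ShortComplex.moduleCat_exact_iff]
      intro y hy
      obtain ⟨y, rfl⟩ := Ideal.Quotient.mk_surjective y
      replace hy : Ideal.Quotient.mk (Ideal.span {x} ⊔ I) y = 0 := hy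
      rw [Ideal.Quotient.eq_zero_iff_mem, Ideal.mem_span_singleton_sup] at hy
      obtain ⟨a, b, hb, rfl⟩ := hy
      refine ⟨Ideal.Quotient.mk I a, ?_⟩
      change Ideal.Quotient.mk I (x * a) = Ideal.Quotient.mk I (a * x + b)
      rw [Ideal.Quotient.eq, mul_comm, sub_add_cancel_left]
      exact neg_mem hb
    · rw [ModuleCat.mono_iff_injective, injective_iff_map_eq_zero]
      intro y hy
      obtain ⟨y, rfl⟩ := Ideal.Quotient.mk_surjective y
      replace hy : Ideal.Quotient.mk I (x * y) = 0 := hy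
      rw [Ideal.Quotient.eq_zero_iff_mem] at hy
      exact Ideal.Quotient.eq_zero_iff_mem.mpr (hx y hy)
    · rw [ModuleCat.epi_iff_surjective]
      exact Ideal.Quotient.factor_surjective hle

theorem topExtCyclic_varIdeal {σ k : Type} [Field k] (T : Finset σ) :
    TopExtCyclic (quotMod k (varIdeal k T)) (ModuleCat.of _ (MvPolynomial σ k)) (varIdeal k T)
      T.card := by
  classical
  induction T using Finset.induction_on with
  | empty =>
    have : varIdeal k (∅ : Finset σ) = ⊥ := by simp [varIdeal]
    rw [this]
    exact topExtCyclic_quotient_bot _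
  | insert a T ha ih =>
    have : varIdeal k (insert a T) = Ideal.span {X a} ⊔ varIdeal k T := by
      rw [varIdeal, Finset.coe_insert, Set.image_insert_eq, Ideal.span_insert, varIdeal]
    rw [this, Finset.card_insert_of_notMem ha]
    refine ih.quotient_sup_span fun p hp => ((isPrime_varIdeal T).mem_or_mem hp).resolve_left ?_
    rwa [X_mem_varIdeal_iff]

theorem TopExtCyclic.annihilator_extM_le {R : Type} [CommRing R] {N : ModuleCat.{0} R}
    {P I : Ideal R} [P.IsPrime] {h : ℕ} (H : TopExtCyclic (ModuleCat.of R (R ⧸ P)) N P h)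
    (hIP : I ≤ P) {g : R} (hg : g ∉ P) (hgP : ∀ a ∈ P, g * a ∈ I) :
    Module.annihilator R (extM (ModuleCat.of R (R ⧸ I)) N h) ≤ P := by
  intro f hf
  obtain ⟨e, he, -⟩ := H.exists_generator
  let p : ModuleCat.of R (R ⧸ I) ⟶ ModuleCat.of R (R ⧸ P) :=
    ModuleCat.ofHom (Submodule.factor hIP)
  let m : ModuleCat.of R (R ⧸ P) ⟶ ModuleCat.of R (R ⧸ I) :=
    ModuleCat.ofHom (Submodule.mapQ P I (LinearMap.mulLeft R g) hgP)
  have hmp : m ≫ p = g • 𝟙 _ := by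
    refine ModuleCat.hom_ext (LinearMap.ext fun y => ?_)
    obtain ⟨y, rfl⟩ := Ideal.Quotient.mk_surjective y
    rfl
  have h1 : g • e = (Ext.mk₀ m).comp ((Ext.mk₀ p).comp e (zero_add h)) (zero_add h) := by
    rw [Ext.mk₀_comp_mk₀_assoc, hmp, Ext.mk₀_smul, Ext.smul_comp, Ext.mk₀_id_comp]
  have h2 : (f * g) • e = 0 := by
    rw [mul_smul, h1, ← Ext.comp_smul, smul_abelianExt_eq_zero hf, Ext.comp_zero]
  exact (Ideal.IsPrime.mem_or_mem ‹_› ((he _).mp h2)).resolve_right hg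

section

variable {σ k : Type} [Fintype σ] [Field k]

theorem card_sub_le_modDim_serreK (K : Set (Finset σ)) {T : Finset σ}
    (hT : varIdeal k T ∈ (srIdeal k K).minimalPrimes) :
    ((Nat.card σ - T.card : ℕ) : WithBot ℕ∞) ≤
      modDim (serreK k (quotMod k (symbPow (srIdeal k K) 1)) (Nat.card σ - T.card)) := by
  classical
  have hprime := isPrime_varIdeal (k := k) T
  have hcard : T.card ≤ Nat.card σ := by
    rw [Nat.card_eq_fintype_card]
    exact T.card_le_univ
  have hle : Module.annihilator _ (serreK k (quotMod k (symbPow (srIdeal k K) 1))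
      (Nat.card σ - T.card)) ≤ varIdeal k T := by
    rw [serreK, Nat.sub_sub_self hcard]
    refine (topExtCyclic_varIdeal T).annihilator_extM_le (g := ∏ i ∈ Tᶜ, X i)
      (fun x hx => by simpa using mem_symbPow_iff.mp hx _ hT) (fun h => ?_)
      fun a ha => mem_symbPow_iff.mpr fun P hP => ?_
    · obtain ⟨i, hi, hiT⟩ := hprime.prod_mem_iff.mp h
      exact Finset.mem_compl.mp hi (X_mem_varIdeal_iff.mp hiT)
    · obtain ⟨T', rfl⟩ := exists_eq_varIdeal_of_mem_minimalPrimes hP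
      rw [pow_one]
      by_cases hTT : T' ⊆ T
      · have h1 : varIdeal k T' ≤ varIdeal k T := Ideal.span_mono (Set.image_mono hTT)
        exact Ideal.mul_mem_left _ _ (hT.2 hP.1 h1 ha)
      · obtain ⟨i, hi, hiT⟩ := Finset.not_subset.mp hTT
        exact Ideal.mul_mem_right _ _ (Ideal.mem_of_dvd _
          (Finset.dvd_prod_of_mem _ (Finset.mem_compl.mpr hiT)) (X_mem_varIdeal hi))
  have h1 : ringKrullDim (MvPolynomial σ k ⧸ varIdeal k T) =
      ringKrullDim (MvPolynomial {i // i ∉ T} k) := by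
    rw [← ker_eraseVars]
    exact ringKrullDim_eq_of_ringEquiv
      (RingHom.quotientKerEquivOfSurjective (eraseVars_surjective (k := k) T))
  have h2 : Nat.card {i // i ∉ T} = Nat.card σ - T.card := by
    rw [Nat.card_eq_fintype_card, Nat.card_eq_fintype_card, Fintype.card_subtype_compl]
    simp
  calc ((Nat.card σ - T.card : ℕ) : WithBot ℕ∞)
      ≤ ringKrullDim k + Nat.card {i // i ∉ T} := by rw [h2]; simp
    _ ≤ ringKrullDim (MvPolynomial {i // i ∉ T} k) :=
      ringKrullDim_add_natCard_le_ringKrullDim_mvPolynomial _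
    _ = ringKrullDim (MvPolynomial σ k ⧸ varIdeal k T) := h1.symm
    _ ≤ _ := ringKrullDim_le_of_surjective _ (Ideal.Quotient.factor_surjective hle)

theorem serreDepth_symbPow_le (K : Set (Finset σ)) (r : ℕ) (hr : 1 ≤ r) {t l l' : ℕ} (ht : 0 < t)
    (hl : 1 ≤ l) (h1 : l' ≤ t * l) (h2 : t * l < l' + t) :
    serreDepth k r (quotMod k (symbPow (srIdeal k K) l')) ≤
      serreDepth k r (quotMod k (symbPow (srIdeal k K) l)) := by
  rcases (srIdeal k K).minimalPrimes.eq_empty_or_nonempty with hmin | ⟨P, hP⟩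
  · have h (m : ℕ) : symbPow (srIdeal k K) m = ⊤ := by simp [symbPow, hmin]
    rw [h, h]
  · obtain ⟨T, rfl⟩ := exists_eq_varIdeal_of_mem_minimalPrimes hP
    refine csInf_le_csInf (OrderBot.bddBelow _) ?_ fun j hj => ?_
    · refine ⟨Nat.card σ - T.card, ?_⟩
      have h3 : ((Nat.card σ - T.card + 1 - r : ℕ) : WithBot ℕ∞) ≤
          (Nat.card σ - T.card : ℕ) := by
        exact_mod_cast (by omega : Nat.card σ - T.card + 1 - r ≤ Nat.card σ - T.card)
      exact (h3.trans (card_sub_le_modDim_serreK K hP)).trans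
        (modDim_serreK_symbPow_le K (t := l) hl (by simp) (by omega) _)
    · exact hj.trans (modDim_serreK_symbPow_le K ht h1 h2 j)

end

end Ext

/-- Theorem `convergent`: for a pure simplicial complex `Δ`, the
sequence `(S_2-depth(S/I_Δ^(ℓ)))_{ℓ ≥ 1}` is convergent (eventually constant, being
integer-valued) and its limit is its minimum value. -/
theorem serreDepth_symbPow_convergent
    (k : Type) [Field k] (n : ℕ)
    (K : Set (Finset (Fin n))) (hK : IsComplex K) (hpure : Pure K) :
    ∃ c : ℕ,
      (∃ N : ℕ, 1 ≤ N ∧ ∀ ℓ : ℕ, N ≤ ℓ →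
        serreDepth k 2 (quotMod k (symbPow (srIdeal k K) ℓ)) = c) ∧
      (∀ ℓ : ℕ, 1 ≤ ℓ → c ≤ serreDepth k 2 (quotMod k (symbPow (srIdeal k K) ℓ))) ∧
      (∃ ℓ : ℕ, 1 ≤ ℓ ∧ serreDepth k 2 (quotMod k (symbPow (srIdeal k K) ℓ)) = c) := by
  let d (l : ℕ) := serreDepth k 2 (quotMod k (symbPow (srIdeal k K) l))
  let A : Set ℕ := d '' Set.Ici 1
  have hA : A.Nonempty := ⟨d 1, 1, Set.self_mem_Ici, rfl⟩
  obtain ⟨l, hl, hlc⟩ : sInf A ∈ A := Nat.sInf_mem hA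
  have hmin (m : ℕ) (hm : 1 ≤ m) : d l ≤ d m := by
    rw [hlc]
    exact Nat.sInf_le ⟨m, hm, rfl⟩
  replace hl : 1 ≤ l := hl
  refine ⟨d l, ⟨l * l + 1, by omega, fun m hm => le_antisymm ?_ (hmin m (by omega))⟩, hmin,
    l, hl, rfl⟩
  have h1 := Nat.div_add_mod m l
  have h2 := Nat.mod_lt m hl
  have h3 : l ≤ m / l := (Nat.le_div_iff_mul_le hl).mpr (by omega)
  refine serreDepth_symbPow_le K 2 (by omega) (t := m / l + 1) (by omega) hl ?_ ?_
  · rw [add_mul, mul_comm]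
    omega
  · rw [add_mul, mul_comm]
    omega

end SerrePaper
end
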